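/- arXiv:1307.0992 — 2 statements merged into one kernel-verified Lean document; each statement's English description precedes it below -/
import Mathlib

section
/- If a graph G contains, for every natural number k, a family of k pairwise edge-disjoint rays all starting at a fixed vertex v, then G contains an infinite family of pairwise edge-disjoint rays all starting at v. -/
open SimpleGraph

variable {V : Type*}

/-- A ray in `G`: an injective sequence of vertices with consecutive vertices adjacent. -/
def IsRay (G : SimpleGraph V) (f : ℕ → V) : Prop :=
  Function.Injective f ∧ ∀ n, G.Adj (f n) (f (n + 1))

/-- A double ray in `G`: an injective two-way infinite sequence with consecutive
vertices adjacent. -/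
def IsDoubleRay (G : SimpleGraph V) (f : ℤ → V) : Prop :=
  Function.Injective f ∧ ∀ n, G.Adj (f n) (f (n + 1))

/-- The edges used by a ray. -/
def rayEdges (f : ℕ → V) : Set (Sym2 V) := {e | ∃ n, e = s(f n, f (n + 1))}

/-- The edges used by a double ray. -/
def drEdges (f : ℤ → V) : Set (Sym2 V) := {e | ∃ n : ℤ, e = s(f n, f (n + 1))}

/-- Two rays are equivalent (belong to the same end) iff no finite vertex set
separates them: for every finite `S` there are tails of both rays avoiding `S`
which are joined by a walk avoiding `S`. -/
def RayEquiv (G : SimpleGraph V) (f g : ℕ → V) : Prop :=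
  ∀ S : Finset V, ∃ a b, (∀ i, a ≤ i → f i ∉ S) ∧ (∀ j, b ≤ j → g j ∉ S) ∧
    ∃ w : G.Walk (f a) (g b), ∀ v ∈ w.support, v ∉ S

/-- The forward ray of a double ray. -/
def drFwd (f : ℤ → V) : ℕ → V := fun n => f n

/-- The backward ray of a double ray. -/
def drBwd (f : ℤ → V) : ℕ → V := fun n => f (-(n : ℤ) - 1)

/-- The end (represented by the ray `R`) has vertex-degree exactly `k`:
there are `k` pairwise vertex-disjoint rays equivalent to `R`, but not `k + 1`. -/
def EndVertexDegree (G : SimpleGraph V) (R : ℕ → V) (k : ℕ) : Prop :=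
  (∃ F : Fin k → ℕ → V, (∀ i, IsRay G (F i) ∧ RayEquiv G R (F i)) ∧
      Pairwise fun i j => Disjoint (Set.range (F i)) (Set.range (F j))) ∧
  ¬ ∃ F : Fin (k + 1) → ℕ → V, (∀ i, IsRay G (F i) ∧ RayEquiv G R (F i)) ∧
      Pairwise fun i j => Disjoint (Set.range (F i)) (Set.range (F j))

/-- An infinite walk in `G` visiting every vertex only finitely often. -/
structure IsLocFinWalk (G : SimpleGraph V) (f : ℕ → V) : Prop where
  adj : ∀ n, G.Adj (f n) (f (n + 1))
  finite_visits : ∀ x, {n | f n = x}.Finite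

/-- There is a family, indexed by `ι`, of pairwise edge-disjoint rays of `G` starting at `v`. -/
def HasRays (G : SimpleGraph V) (v : V) (ι : Type*) : Prop :=
  ∃ F : ι → ℕ → V, (∀ i, IsRay G (F i) ∧ F i 0 = v) ∧
    Pairwise fun i j => Disjoint (rayEdges (F i)) (rayEdges (F j))

/-- The graph `G` with all edges at vertices of `D` removed. -/
def delVerts (G : SimpleGraph V) (D : Set V) : SimpleGraph V where
  Adj a b := G.Adj a b ∧ a ∉ D ∧ b ∉ D
  symm := ⟨fun _ _ h => ⟨h.1.symm, h.2.2, h.2.1⟩⟩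
  loopless := ⟨fun _ h => h.1.ne rfl⟩

/-- No finite set of edges separates `a` from `b`. -/
def InfConn (G : SimpleGraph V) (a b : V) : Prop :=
  ∀ F : Set (Sym2 V), F.Finite → (G.deleteEdges F).Reachable a b

theorem mem_rayEdges (f : ℕ → V) (n : ℕ) : s(f n, f (n + 1)) ∈ rayEdges f := ⟨n, rfl⟩

theorem delVerts_le (G : SimpleGraph V) (D : Set V) : delVerts G D ≤ G := fun _ _ h => h.1

theorem delVerts_mono {G H : SimpleGraph V} (h : G ≤ H) (D : Set V) :
    delVerts G D ≤ delVerts H D := fun _ _ hab => ⟨h hab.1, hab.2⟩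

theorem delVerts_insert (G : SimpleGraph V) (D : Set V) (u : V) :
    delVerts G (insert u D) = delVerts (delVerts G D) {u} := by
  ext a b
  simp only [delVerts, Set.mem_insert_iff, Set.mem_singleton_iff]
  tauto

theorem IsRay.mono {G H : SimpleGraph V} (h : G ≤ H) {f : ℕ → V} (hf : IsRay G f) : IsRay H f :=
  ⟨hf.1, fun n => h (hf.2 n)⟩

theorem IsRay.isLocFinWalk {G : SimpleGraph V} {f : ℕ → V} (hf : IsRay G f) :
    IsLocFinWalk G f :=
  ⟨hf.2, fun _ => Set.Subsingleton.finite fun _ ha _ hb => hf.1 (ha.trans hb.symm)⟩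

theorem IsRay.delVerts {G : SimpleGraph V} {f : ℕ → V} {D : Set V} (hf : IsRay G f)
    (h : ∀ n, f n ∉ D) : IsRay (delVerts G D) f :=
  ⟨hf.1, fun n => ⟨hf.2 n, h n, h (n + 1)⟩⟩

theorem IsRay.deleteEdges {G : SimpleGraph V} {f : ℕ → V} {F : Set (Sym2 V)} (hf : IsRay G f)
    (h : Disjoint (rayEdges f) F) : IsRay (G.deleteEdges F) f :=
  ⟨hf.1, fun n => SimpleGraph.deleteEdges_adj.2
    ⟨hf.2 n, fun hn => Set.disjoint_left.1 h (mem_rayEdges f n) hn⟩⟩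

theorem IsRay.tail {G : SimpleGraph V} {f : ℕ → V} (hf : IsRay G f) (a : ℕ) :
    IsRay G (fun n => f (a + n)) :=
  ⟨fun _ _ h => by simpa using hf.1 h, fun n => hf.2 (a + n)⟩

theorem IsLocFinWalk.tail {G : SimpleGraph V} {f : ℕ → V} (hf : IsLocFinWalk G f) (a : ℕ) :
    IsLocFinWalk G (fun n => f (a + n)) :=
  ⟨fun n => hf.adj (a + n), fun x =>
    (hf.finite_visits x).preimage (f := fun n => a + n) (fun _ _ _ _ h => by simpa using h)⟩

theorem rayEdges_tail_subset (f : ℕ → V) (a : ℕ) : rayEdges (fun n => f (a + n)) ⊆ rayEdges f := by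
  rintro e ⟨n, rfl⟩
  exact ⟨a + n, rfl⟩

theorem HasRays.mono {G H : SimpleGraph V} (h : G ≤ H) {v : V} {ι : Type*}
    (hG : HasRays G v ι) : HasRays H v ι := by
  obtain ⟨F, hF, hd⟩ := hG
  exact ⟨F, fun i => ⟨(hF i).1.mono h, (hF i).2⟩, hd⟩

/-- A locally finite walk contains a ray with the same start vertex. -/
theorem IsLocFinWalk.exists_isRay {G : SimpleGraph V} {f : ℕ → V} (hf : IsLocFinWalk G f) :
    ∃ g, IsRay G g ∧ g 0 = f 0 ∧ rayEdges g ⊆ rayEdges f := by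
  have hlast : ∀ n, ∃ m, f m = f n ∧ ∀ k, m < k → f k ≠ f n := by
    intro n
    obtain ⟨m, hm⟩ := (hf.finite_visits (f n)).exists_maximal ⟨n, rfl⟩
    exact ⟨m, hm.1, fun k hk hkn => absurd (hm.2 (show k ∈ {l | f l = f n} from hkn) hk.le)
      (not_le.2 hk)⟩
  choose L hL hL' using hlast
  have hle : ∀ n, n ≤ L n := fun n => by
    by_contra h
    exact hL' n n (not_le.1 h) rfl
  let I : ℕ → ℕ := fun k => Nat.rec (L 0) (fun _ m => L (m + 1)) k
  have hIs : ∀ k, I (k + 1) = L (I k + 1) := fun _ => rfl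
  have hmono : StrictMono I := strictMono_nat_of_lt_succ fun k => by
    rw [hIs]; exact hle (I k + 1)
  have hIL : ∀ k, ∃ n, I k = L n := by
    rintro (_ | k)
    exacts [⟨0, rfl⟩, ⟨_, hIs k⟩]
  have hgs : ∀ k, f (I (k + 1)) = f (I k + 1) := fun k => by rw [hIs, hL]
  have hne : ∀ k l, k < l → f (I l) ≠ f (I k) := by
    intro k l hkl
    obtain ⟨n, hn⟩ := hIL k
    have := hL' n (I l) (hn ▸ hmono hkl)
    rwa [hn, hL]
  refine ⟨fun k => f (I k), ⟨fun k l h => ?_, fun k => ?_⟩, hL 0, ?_⟩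
  · rcases lt_trichotomy k l with hkl | hkl | hkl
    · exact absurd h.symm (hne k l hkl)
    · exact hkl
    · exact absurd h (hne l k hkl)
  · change G.Adj (f (I k)) (f (I (k + 1)))
    rw [hgs]; exact hf.adj _
  · rintro e ⟨k, rfl⟩
    exact ⟨I k, by simp only [hgs]⟩

theorem hasRays_of_isLocFinWalk {G : SimpleGraph V} {v : V} {ι : Type*} (F : ι → ℕ → V)
    (hF : ∀ i, IsLocFinWalk G (F i) ∧ F i 0 = v)
    (hd : Pairwise fun i j => Disjoint (rayEdges (F i)) (rayEdges (F j))) : HasRays G v ι := by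
  choose g hg h0 hs using fun i => (hF i).1.exists_isRay
  exact ⟨g, fun i => ⟨hg i, (h0 i).trans (hF i).2⟩,
    fun i j hij => (hd hij).mono (hs i) (hs j)⟩

/-- Follow the walk `f` for `a` steps, then switch to `g` at its `b`-th vertex. -/
theorem IsLocFinWalk.splice {G : SimpleGraph V} {f g : ℕ → V} {a b : ℕ}
    (hf : ∀ n < a, G.Adj (f n) (f (n + 1))) (hg : IsLocFinWalk G g) (hab : f a = g b) :
    ∃ T, IsLocFinWalk G T ∧ (∀ m ≤ a, T m = f m) ∧ (∀ m, T (a + m) = g (b + m)) ∧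
      ∀ e ∈ rayEdges T, (∃ m < a, e = s(f m, f (m + 1))) ∨ ∃ m ≥ b, e = s(g m, g (m + 1)) := by
  let T : ℕ → V := fun m => if m ≤ a then f m else g (b + (m - a))
  have h1 : ∀ m ≤ a, T m = f m := fun m hm => if_pos hm
  have h2 : ∀ m, T (a + m) = g (b + m) := by
    rintro (_ | m)
    · simpa [T] using hab
    · simp [T]
  have h3 : ∀ m, (m < a ∧ T m = f m ∧ T (m + 1) = f (m + 1)) ∨
      ∃ k ≥ b, T m = g k ∧ T (m + 1) = g (k + 1) := by
    intro m
    rcases lt_or_ge m a with hm | hm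
    · exact Or.inl ⟨hm, h1 m hm.le, h1 (m + 1) hm⟩
    · obtain ⟨k, rfl⟩ := Nat.exists_eq_add_of_le hm
      exact Or.inr ⟨b + k, by omega, h2 k, h2 (k + 1)⟩
  refine ⟨T, ⟨fun m => ?_, fun x => ?_⟩, h1, h2, ?_⟩
  · rcases h3 m with ⟨hm, h, h'⟩ | ⟨k, -, h, h'⟩
    · rw [h, h']; exact hf m hm
    · rw [h, h']; exact hg.adj k
  · refine ((Set.finite_le_nat a).union
      (((hg.finite_visits x).image fun k => a + (k - b)))).subset fun m hm => ?_
    rcases le_total m a with h | h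
    · exact Or.inl h
    · obtain ⟨k, rfl⟩ := Nat.exists_eq_add_of_le h
      exact Or.inr ⟨b + k, (h2 k).symm.trans hm, by simp⟩
  · rintro e ⟨m, rfl⟩
    rcases h3 m with ⟨hm, h, h'⟩ | ⟨k, hk, h, h'⟩
    · exact Or.inl ⟨m, hm, by rw [h, h']⟩
    · exact Or.inr ⟨k, hk, by rw [h, h']⟩

theorem IsLocFinWalk.finite_edge_visits {G : SimpleGraph V} {f : ℕ → V} (hf : IsLocFinWalk G f)
    (e : Sym2 V) : {n | s(f n, f (n + 1)) = e}.Finite := by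
  induction e using Sym2.ind with
  | _ a b =>
    refine ((hf.finite_visits a).union (hf.finite_visits b)).subset fun n hn => ?_
    rcases Sym2.eq_iff.1 hn with h | h
    exacts [Or.inl h.1, Or.inr h.1]

/-- Only finitely many members of a disjoint family meet a given finite set. -/
theorem ncard_not_disjoint_le {ι α : Type*} {E : ι → Set α}
    (hE : Pairwise fun i j => Disjoint (E i) (E j)) {F : Set α} (hF : F.Finite) :
    {i | ¬ Disjoint (E i) F}.Finite ∧ {i | ¬ Disjoint (E i) F}.ncard ≤ F.ncard := by
  have h : ∀ i : {i | ¬ Disjoint (E i) F}, ∃ x, x ∈ E i ∧ x ∈ F := fun i =>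
    Set.not_disjoint_iff.1 i.2
  choose x hx hxF using h
  have hinj : Function.Injective fun i => (⟨x i, hxF i⟩ : F) := by
    intro i j hij
    by_contra hne
    have hxx : x i = x j := congrArg Subtype.val hij
    exact Set.disjoint_left.1 (hE fun h => hne (Subtype.ext h)) (hx i) (hxx ▸ hx j)
  have := hF.to_subtype
  exact ⟨Finite.of_injective _ hinj, Nat.card_le_card_of_injective _ hinj⟩

/-- Build a sequence whose `n`-th term has a property depending on `n` and is
related to all earlier terms. -/
theorem exists_seq_of_forall_list {α : Type*} (P : ℕ → α → Prop) (r : α → α → Prop)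
    (h : ∀ n (s : List α), (∀ x ∈ s, ∃ m, P m x) → ∃ y, P n y ∧ ∀ x ∈ s, r x y) :
    ∃ f : ℕ → α, (∀ n, P n (f n)) ∧ ∀ m n, m < n → r (f m) (f n) := by
  choose y hy hr using h
  let L : ℕ → {s : List α // ∀ x ∈ s, ∃ m, P m x} := fun n =>
    Nat.rec ⟨[], by simp⟩ (fun n s => ⟨y n s.1 s.2 :: s.1, by
      intro x hx
      rcases List.mem_cons.1 hx with rfl | hx
      exacts [⟨n, hy n s.1 s.2⟩, s.2 x hx]⟩) n
  have hL : ∀ n, (L (n + 1)).1 = y n (L n).1 (L n).2 :: (L n).1 := fun _ => rfl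
  refine ⟨fun n => y n (L n).1 (L n).2, fun n => hy _ _ _, fun m n hmn => hr _ _ _ _ ?_⟩
  induction n, hmn using Nat.le_induction with
  | base => rw [hL]; exact List.mem_cons_self
  | succ n _ ih => rw [hL]; exact List.mem_cons_of_mem _ ih

/-- **Linkage.** Given pairwise edge-disjoint walks `R i` and pairwise edge-disjoint locally finite
walks `Q j`, a Gale–Shapley procedure (in which each `R i` proposes its edges in order and each
`Q j` accepts the latest of its edges proposed so far) reroutes every `R i`, possibly onto a final
segment of some `Q j`. Here `S` is the set of edges ever proposed, and `J` the set of those `j`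
for which `Q j` receives a proposal. -/
theorem exists_linkage {G : SimpleGraph V} {ι κ : Type*} [Fintype ι] [Fintype κ]
    (R : ι → ℕ → V) (Q : κ → ℕ → V) (hR : ∀ i n, G.Adj (R i n) (R i (n + 1)))
    (hRd : Pairwise fun i j => Disjoint (rayEdges (R i)) (rayEdges (R j)))
    (hQ : ∀ j, IsLocFinWalk G (Q j))
    (hQd : Pairwise fun i j => Disjoint (rayEdges (Q i)) (rayEdges (Q j))) :
    ∃ (S : Set (Sym2 V)) (J : Finset κ) (T : ι → ℕ → V), J.card ≤ Fintype.card ι ∧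
      (∀ j, j ∉ J → Disjoint (rayEdges (Q j)) S) ∧
      (Pairwise fun i j => Disjoint (rayEdges (T i)) (rayEdges (T j))) ∧
      ∀ i, T i 0 = R i 0 ∧
        (∀ e ∈ rayEdges (T i), (e ∈ rayEdges (R i) ∧ e ∈ S) ∨ ∃ j ∈ J, e ∈ rayEdges (Q j)) ∧
        (IsLocFinWalk G (T i) ∨
          T i = R i ∧ rayEdges (R i) ⊆ S ∧ J.card < Fintype.card ι) := by
  classical
  let E : (ℕ → V) → ℕ → Sym2 V := fun f n => s(f n, f (n + 1))
  let rej : Set (Sym2 V) → Sym2 V → Prop := fun S e =>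
    ∀ j b, E (Q j) b = e → ∃ b' > b, E (Q j) b' ∈ S
  have rej_mono : ∀ {S S' : Set (Sym2 V)} {e}, S ⊆ S' → rej S e → rej S' e :=
    fun hS h j b hb => (h j b hb).imp fun b' hb' => ⟨hb'.1, hS hb'.2⟩
  let prop : (ι → ℕ) → Set (Sym2 V) := fun a => {e | ∃ i m, m ≤ a i ∧ E (R i) m = e}
  have prop_fin : ∀ a, (prop a).Finite := fun a => by
    refine (Set.finite_iUnion fun i => (Set.finite_le_nat (a i)).image (E (R i))).subset ?_
    rintro e ⟨i, m, hm, rfl⟩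
    exact Set.mem_iUnion.2 ⟨i, m, hm, rfl⟩
  let A : ℕ → ι → ℕ := fun t => Nat.rec (fun _ => 0)
    (fun _ a i => if rej (prop a) (E (R i) (a i)) then a i + 1 else a i) t
  have hA : ∀ t i, A (t + 1) i =
      if rej (prop (A t)) (E (R i) (A t i)) then A t i + 1 else A t i := fun _ _ => rfl
  have A_mono : ∀ i, Monotone fun t => A t i := fun i =>
    monotone_nat_of_le_succ fun t => by rw [hA]; split_ifs <;> omega
  have S_mono : Monotone fun t => prop (A t) := by
    rintro t t' h e ⟨i, m, hm, rfl⟩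
    exact ⟨i, m, hm.trans (A_mono i h), rfl⟩
  have inv : ∀ t i m, m < A t i → rej (prop (A t)) (E (R i) m) := by
    intro t
    induction t with
    | zero => intro i m hm; exact absurd hm (Nat.not_lt_zero _)
    | succ t ih =>
      intro i m hm
      refine rej_mono (S_mono t.le_succ) ?_
      rw [hA] at hm
      split_ifs at hm with h
      · rcases Nat.lt_succ_iff_lt_or_eq.1 hm with hm | rfl
        exacts [ih i m hm, h]
      · exact ih i m hm
  let S : Set (Sym2 V) := ⋃ t, prop (A t)
  have subS : ∀ t, prop (A t) ⊆ S := fun t => Set.subset_iUnion (fun t => prop (A t)) t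
  have holder : ∀ t j, (∃ b, E (Q j) b ∈ prop (A t)) →
      ∃ i, ¬ rej (prop (A t)) (E (R i) (A t i)) ∧ E (R i) (A t i) ∈ rayEdges (Q j) := by
    intro t j hj
    have hfin : {b | E (Q j) b ∈ prop (A t)}.Finite := by
      refine ((prop_fin (A t)).biUnion fun e _ => (hQ j).finite_edge_visits e).subset ?_
      intro b hb
      exact Set.mem_biUnion hb rfl
    obtain ⟨b, hb, hmax⟩ := hfin.exists_maximal hj
    obtain ⟨i, m, hm, he⟩ := hb
    have hnr : ¬ rej (prop (A t)) (E (R i) m) := fun h => by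
      obtain ⟨b', hb', hb'S⟩ := h j b he.symm
      exact absurd (hmax hb'S (le_of_lt hb')) (not_le.2 hb')
    have hmA : m = A t i := by
      by_contra hne
      exact hnr (inv t i m (lt_of_le_of_ne hm hne))
    subst hmA
    exact ⟨i, hnr, b, he⟩
  let J : Finset κ := Finset.univ.filter fun j => ∃ b, E (Q j) b ∈ S
  have hJ : ∀ j ∈ J, ∃ t, ∃ b, E (Q j) b ∈ prop (A t) := by
    intro j hj
    obtain ⟨b, hb⟩ := (Finset.mem_filter.1 hj).2
    obtain ⟨t, ht⟩ := Set.mem_iUnion.1 hb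
    exact ⟨t, b, ht⟩
  obtain ⟨t₀, ht₀⟩ : ∃ t₀, ∀ t ≥ t₀, ∀ j ∈ J, ∃ b, E (Q j) b ∈ prop (A t) := by
    choose! τ hτ using hJ
    refine ⟨J.sup τ, fun t ht j hj => ?_⟩
    obtain ⟨b, hb⟩ := hτ j hj
    exact ⟨b, S_mono ((Finset.le_sup hj).trans ht) hb⟩
  have hhold : ∀ t ≥ t₀, ∃ h : J → ι, Function.Injective h ∧
      ∀ j, ¬ rej (prop (A t)) (E (R (h j)) (A t (h j))) := by
    intro t ht
    choose h hh hh' using fun j : J => holder t j (ht₀ t ht j j.2)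
    refine ⟨h, fun j j' hjj => ?_, hh⟩
    by_contra hne
    have h1 := hh' j
    rw [hjj] at h1
    exact Set.disjoint_left.1 (hQd fun h => hne (Subtype.ext h)) h1 (hh' j')
  have hcard : J.card ≤ Fintype.card ι := by
    obtain ⟨h, hinj, -⟩ := hhold t₀ le_rfl
    simpa using Fintype.card_le_of_injective h hinj
  have hstab : J.card = Fintype.card ι → ∀ i, ∀ t ≥ t₀, A (t + 1) i = A t i := by
    intro hc i t ht
    obtain ⟨h, hinj, hr⟩ := hhold t ht
    have hb := (Fintype.bijective_iff_injective_and_card h).2 ⟨hinj, by simpa using hc⟩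
    obtain ⟨j, rfl⟩ := hb.2 i
    rw [hA, if_neg (hr j)]
  have key : ∀ i, ∃ (T : ℕ → V) (C : Set (Sym2 V)),
      T 0 = R i 0 ∧ (∀ e ∈ rayEdges T, (e ∈ rayEdges (R i) ∧ e ∈ S) ∨ e ∈ C) ∧
      (IsLocFinWalk G T ∨ T = R i ∧ rayEdges (R i) ⊆ S ∧ J.card < Fintype.card ι) ∧
      (C = ∅ ∨ ∃ j ∈ J, ∃ β, E (Q j) β ∈ S ∧ E (Q j) β ∈ rayEdges (R i) ∧
        (∀ b > β, E (Q j) b ∉ S) ∧ C = {e | ∃ b > β, e = E (Q j) b}) := by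
    intro i
    rcases em (∃ t₁, ∀ t ≥ t₁, A (t + 1) i = A t i) with ⟨t₁, ht₁⟩ | hst
    · have hconst : ∀ t ≥ t₁, A t i = A t₁ i := by
        intro t ht
        induction t, ht using Nat.le_induction with
        | base => rfl
        | succ t ht ih => rw [ht₁ t ht, ih]
      set α := A t₁ i with hα
      have hnr : ∀ t ≥ t₁, ¬ rej (prop (A t)) (E (R i) α) := by
        intro t ht hr
        have h1 := ht₁ t ht
        rw [hA, if_pos (by rwa [hconst t ht])] at h1
        omega
      have heS : ∀ m ≤ α, E (R i) m ∈ S := fun m hm => subS t₁ ⟨i, m, hm, rfl⟩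
      obtain ⟨j, b₀, hb₀⟩ : ∃ j b, E (Q j) b = E (R i) α := by
        have := hnr t₁ le_rfl
        simp only [rej] at this
        push Not at this
        obtain ⟨j, b, hb, -⟩ := this
        exact ⟨j, b, hb⟩
      obtain ⟨β, hβ, hβmax⟩ :=
        ((hQ j).finite_edge_visits (E (R i) α)).exists_maximal ⟨b₀, hb₀⟩
      have hβ : E (Q j) β = E (R i) α := hβ
      have hlast : ∀ b > β, E (Q j) b ∉ S := by
        intro b hb hbS
        obtain ⟨t, ht⟩ := Set.mem_iUnion.1 hbS
        have hbt := S_mono (le_max_left t t₁) ht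
        refine hnr (max t t₁) (le_max_right _ _) fun j' b' hb' => ?_
        have hjj : j' = j := by
          by_contra hne
          exact Set.disjoint_left.1 (hQd hne) ⟨b', rfl⟩ ⟨β, hb'.trans hβ.symm⟩
        subst hjj
        refine ⟨b, lt_of_le_of_lt ?_ hb, hbt⟩
        rcases le_total b' β with h | h
        · exact h
        · exact hβmax hb' h
      obtain ⟨a, ha, haQ⟩ : ∃ a ≤ α + 1, R i a = Q j (β + 1) := by
        rcases Sym2.eq_iff.1 hβ with h | h
        · exact ⟨α + 1, le_rfl, h.2.symm⟩
        · exact ⟨α, α.le_succ, h.2.symm⟩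
      obtain ⟨T, hT, hT0, -, hTe⟩ := IsLocFinWalk.splice (fun n _ => hR i n) (hQ j) haQ
      refine ⟨T, {e | ∃ b > β, e = E (Q j) b}, hT0 0 (Nat.zero_le _), fun e he => ?_, Or.inl hT,
        Or.inr ⟨j, ?_, β, ?_, ⟨α, hβ⟩, hlast, rfl⟩⟩
      · rcases hTe e he with ⟨m, hm, rfl⟩ | ⟨m, hm, rfl⟩
        · exact Or.inl ⟨⟨m, rfl⟩, heS m (by omega)⟩
        · exact Or.inr ⟨m, hm, rfl⟩
      · exact Finset.mem_filter.2 ⟨Finset.mem_univ _, β, hβ ▸ heS α le_rfl⟩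
      · exact hβ ▸ heS α le_rfl
    · refine ⟨R i, ∅, rfl, ?_, Or.inr ⟨rfl, ?_, ?_⟩, Or.inl rfl⟩
      all_goals
        have hsub : rayEdges (R i) ⊆ S := by
          push Not at hst
          have hub : ∀ m, ∃ t, m ≤ A t i := by
            intro m
            induction m with
            | zero => exact ⟨0, Nat.zero_le _⟩
            | succ m ih =>
              obtain ⟨t, ht⟩ := ih
              obtain ⟨t', htt', hne⟩ := hst t
              refine ⟨t' + 1, ?_⟩
              have h1 := A_mono i htt'
              have h2 := A_mono i (Nat.le_add_right t' 1)
              simp only at h1 h2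
              omega
          rintro e ⟨m, rfl⟩
          obtain ⟨t, ht⟩ := hub m
          exact subS t ⟨i, m, ht, rfl⟩
      · exact fun e he => Or.inl ⟨he, hsub he⟩
      · exact hsub
      · exact lt_of_le_of_ne hcard fun hc => hst ⟨t₀, hstab hc i⟩
  choose T C hT0 hTe hTl hC using key
  have hCQ : ∀ i, ∀ e ∈ C i, e ∉ S ∧ ∃ j ∈ J, e ∈ rayEdges (Q j) := by
    intro i e he
    rcases hC i with h | ⟨j, hj, β, -, -, hlast, h⟩
    · rw [h] at he; exact he.elim
    · rw [h] at he
      obtain ⟨b, hb, rfl⟩ := he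
      exact ⟨hlast b hb, j, hj, b, rfl⟩
  have hCd : ∀ i i', i ≠ i' → Disjoint (C i) (C i') := by
    intro i i' hii
    rcases hC i with h | ⟨j, -, β, hβS, hβR, hlast, h⟩
    · rw [h]; exact Set.empty_disjoint _
    rcases hC i' with h' | ⟨j', -, β', hβS', hβR', hlast', h'⟩
    · rw [h']; exact Set.disjoint_empty _
    by_cases hjj : j = j'
    · subst hjj
      rcases lt_trichotomy β β' with hl | rfl | hl
      · exact absurd hβS' (hlast _ hl)
      · exact absurd hβR' (Set.disjoint_left.1 (hRd hii) hβR)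
      · exact absurd hβS (hlast' _ hl)
    · rw [h, h']
      refine (hQd hjj).mono ?_ ?_
      all_goals
        rintro e ⟨b, -, rfl⟩
        exact ⟨b, rfl⟩
  refine ⟨S, J, T, hcard, fun j hj => ?_, fun i i' hii => ?_, fun i =>
    ⟨hT0 i, fun e he => (hTe i e he).imp_right fun h => (hCQ i e h).2, hTl i⟩⟩
  · rw [Set.disjoint_left]
    rintro e ⟨b, rfl⟩ hb
    exact hj (Finset.mem_filter.2 ⟨Finset.mem_univ _, b, hb⟩)
  · refine Set.disjoint_left.2 fun e he he' => ?_
    rcases hTe i e he with ⟨h1, h2⟩ | h1 <;> rcases hTe i' e he' with ⟨h1', h2'⟩ | h1'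
    · exact Set.disjoint_left.1 (hRd hii) h1 h1'
    · exact (hCQ i' e h1').1 h2
    · exact (hCQ i e h1).1 h2'
    · exact Set.disjoint_left.1 (hCd i i' hii) h1 h1'

theorem HasRays.of_le_card {G : SimpleGraph V} {v : V} {ι : Type*} {F : ι → ℕ → V}
    (hd : Pairwise fun i j => Disjoint (rayEdges (F i)) (rayEdges (F j))) (s : Finset ι)
    (hF : ∀ i ∈ s, IsRay G (F i) ∧ F i 0 = v) {k : ℕ} (hk : k ≤ s.card) :
    HasRays G v (Fin k) := by
  let g : Fin k ↪ ι := (Fin.castLEEmb hk).trans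
    (s.equivFin.symm.toEmbedding.trans (Function.Embedding.subtype _))
  exact ⟨fun i => F (g i), fun i => hF _ (s.equivFin.symm (Fin.castLEEmb hk i)).2,
    fun i j hij => hd (g.injective.ne hij)⟩

/-- Deleting finitely many edges preserves the existence of arbitrarily many edge-disjoint rays. -/
theorem HasRays.deleteEdges {G : SimpleGraph V} {v : V} (h : ∀ k, HasRays G v (Fin k))
    {E : Set (Sym2 V)} (hE : E.Finite) (k : ℕ) : HasRays (G.deleteEdges E) v (Fin k) := by
  classical
  obtain ⟨F, hF, hd⟩ := h (k + E.ncard)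
  obtain ⟨hfin, hcard⟩ := ncard_not_disjoint_le hd hE
  refine HasRays.of_le_card hd (Finset.univ.filter fun i => Disjoint (rayEdges (F i)) E)
    (fun i hi => ⟨(hF i).1.deleteEdges (Finset.mem_filter.1 hi).2, (hF i).2⟩) ?_
  have h1 := Finset.card_filter_add_card_filter_not (s := (Finset.univ : Finset (Fin (k + E.ncard))))
    (fun i => Disjoint (rayEdges (F i)) E)
  rw [Set.ncard_eq_toFinset_card'] at hcard
  simp only [Set.toFinset_ofPred, Finset.card_univ, Fintype.card_fin] at hcard h1
  omega

/-- One extension step: prolong `n` locally finite walks from `v` beyond a common length such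
that they avoid `D` from then on, and add another one. -/
theorem exists_extension {G : SimpleGraph V} {v : V} {D : Set V} (hD : D.Finite)
    (hbig : ∀ k, HasRays (delVerts G D) v (Fin k)) (n ℓ : ℕ) (R : ℕ → ℕ → V)
    (hR : ∀ i < n, R i 0 = v ∧ IsLocFinWalk G (R i) ∧ ∀ m, R i (m + 1) ≠ v)
    (hRd : ∀ i < n, ∀ j < n, i ≠ j → Disjoint (rayEdges (R i)) (rayEdges (R j))) :
    ∃ (R' : ℕ → ℕ → V) (ℓ' : ℕ), ℓ ≤ ℓ' ∧
      (∀ i < n + 1, R' i 0 = v ∧ IsLocFinWalk G (R' i) ∧ ∀ m, R' i (m + 1) ≠ v) ∧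
      (∀ i < n + 1, ∀ j < n + 1, i ≠ j → Disjoint (rayEdges (R' i)) (rayEdges (R' j))) ∧
      (∀ i < n + 1, ∀ m ≥ ℓ', R' i m ∉ D) ∧ ∀ i < n, ∀ m ≤ ℓ', R' i m = R i m := by
  classical
  obtain ⟨M, hM⟩ : ∃ M, ∀ i < n, ∀ m ≥ M, R i m ∉ D := by
    have hfin : (⋃ i ∈ Set.Iio n, ⋃ x ∈ D, {m | R i m = x}).Finite :=
      (Set.finite_Iio n).biUnion fun i hi => hD.biUnion fun x _ => (hR i hi).2.1.finite_visits x
    obtain ⟨M, hM⟩ := hfin.bddAbove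
    refine ⟨M + 1, fun i hi m hm hmD => ?_⟩
    have := hM (Set.mem_biUnion (show i ∈ Set.Iio n from hi) (Set.mem_biUnion hmD rfl))
    omega
  let ℓ' := max M ℓ + 1
  have hℓ' : ∀ i < n, ∀ m ≥ ℓ', R i m ∉ D := fun i hi m hm => hM i hi m (by omega)
  let F : Set (Sym2 V) := ⋃ i ∈ Set.Iio n, (fun m => s(R i m, R i (m + 1))) '' Set.Iio ℓ'
  have hF : F.Finite := (Set.finite_Iio n).biUnion fun i _ => (Set.finite_Iio ℓ').image _
  have hFm : ∀ i < n, ∀ m < ℓ', s(R i m, R i (m + 1)) ∈ F := fun i hi m hm =>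
    Set.mem_biUnion (show i ∈ Set.Iio n from hi) ⟨m, hm, rfl⟩
  obtain ⟨Q, hQ, hQd⟩ := HasRays.deleteEdges hbig hF (n + 1)
  have hQadj : ∀ j m, G.Adj (Q j m) (Q j (m + 1)) ∧ Q j m ∉ D ∧ Q j (m + 1) ∉ D ∧
      s(Q j m, Q j (m + 1)) ∉ F := by
    intro j m
    obtain ⟨⟨h1, h2, h3⟩, h4⟩ := SimpleGraph.deleteEdges_adj.1 ((hQ j).1.2 m)
    exact ⟨h1, h2, h3, h4⟩
  have hQF : ∀ j, ∀ e ∈ rayEdges (Q j), e ∉ F := by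
    rintro j e ⟨m, rfl⟩
    exact (hQadj j m).2.2.2
  have hQv : ∀ j m, Q j (m + 1) ≠ v := fun j m h => by
    simpa using (hQ j).1.1 (h.trans (hQ j).2.symm)
  have hQr : ∀ j, IsRay G (Q j) := fun j => ⟨(hQ j).1.1, fun m => (hQadj j m).1⟩
  obtain ⟨S, J, T, hJ, hJS, hTd, hT⟩ := exists_linkage (G := G) (fun (i : Fin n) m => R i (ℓ' + m))
    (fun j m => Q j (1 + m)) (fun i m => (hR i i.2).2.1.adj (ℓ' + m))
    (fun i j hij => (hRd i i.2 j j.2 (Fin.val_ne_of_ne hij)).mono (rayEdges_tail_subset _ _)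
      (rayEdges_tail_subset _ _))
    (fun j => ((hQr j).tail 1).isLocFinWalk)
    (fun i j hij => (hQd hij).mono (rayEdges_tail_subset _ _) (rayEdges_tail_subset _ _))
  obtain ⟨j₀, hj₀⟩ : ∃ j, j ∉ J := by
    by_contra! h
    have : J = Finset.univ := Finset.eq_univ_iff_forall.2 h
    simp [this] at hJ
  have hTlf : ∀ i, IsLocFinWalk G (T i) := fun i => by
    rcases (hT i).2.2 with h | ⟨h, -⟩
    · exact h
    · rw [h]; exact (hR i i.2).2.1.tail ℓ'
  have hTe : ∀ i, ∀ e ∈ rayEdges (T i),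
      (e ∈ rayEdges (R i) ∧ e ∈ S) ∨ ∃ j ∈ J, e ∈ rayEdges (fun m => Q j (1 + m)) := by
    intro i e he
    exact ((hT i).2.1 e he).imp_left fun h => ⟨rayEdges_tail_subset _ _ h.1, h.2⟩
  have hTv : ∀ i m, T i m ∉ D ∧ T i m ≠ v := by
    intro i m
    have hmem : T i m ∈ s(T i m, T i (m + 1)) := Sym2.mem_mk_left _ _
    rcases (hT i).2.1 _ (mem_rayEdges (T i) m) with ⟨⟨k, hk⟩, -⟩ | ⟨j, -, k, hk⟩
    · rw [hk] at hmem
      rcases Sym2.mem_iff.1 hmem with h | h <;> rw [h]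
      · refine ⟨hℓ' i i.2 _ (by omega), ?_⟩
        have := (hR i i.2).2.2 (ℓ' + k - 1)
        rwa [show ℓ' + k - 1 + 1 = ℓ' + k by omega] at this
      · exact ⟨hℓ' i i.2 _ (by omega), (hR i i.2).2.2 (ℓ' + k)⟩
    · rw [hk] at hmem
      rcases Sym2.mem_iff.1 hmem with h | h <;> rw [h]
      · exact ⟨(hQadj j (1 + k)).2.1, by simpa only [add_comm] using hQv j k⟩
      · exact ⟨(hQadj j (1 + k)).2.2.1, hQv j (1 + k)⟩
  choose P hP hPl hPr hPe using fun i : Fin n =>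
    IsLocFinWalk.splice (G := G) (fun n _ => (hR i i.2).2.1.adj n) (hTlf i) (a := ℓ') (b := 0) (hT i).1.symm
  have hPd : ∀ i j, i ≠ j → Disjoint (rayEdges (P i)) (rayEdges (P j)) := by
    have hFT : ∀ i j : Fin n, i ≠ j → ∀ m < ℓ', s(R i m, R i (m + 1)) ∉ rayEdges (T j) := by
      intro i j hij m hm h
      rcases hTe j _ h with h | ⟨k, -, h⟩
      · exact Set.disjoint_left.1 (hRd i i.2 j j.2 (Fin.val_ne_of_ne hij)) ⟨m, rfl⟩ h.1
      · exact hQF k _ (rayEdges_tail_subset _ _ h) (hFm i i.2 m hm)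
    intro i j hij
    rw [Set.disjoint_left]
    intro e hi hj
    rcases hPe i e hi with ⟨m, hm, rfl⟩ | ⟨m, -, rfl⟩
    · rcases hPe j _ hj with ⟨m', -, h⟩ | ⟨m', -, h⟩
      · exact Set.disjoint_left.1 (hRd i i.2 j j.2 (Fin.val_ne_of_ne hij)) ⟨m, rfl⟩ ⟨m', h⟩
      · exact hFT i j hij m hm ⟨m', h⟩
    · rcases hPe j _ hj with ⟨m', hm', h⟩ | ⟨m', -, h⟩
      · exact hFT j i hij.symm m' hm' ⟨m, h.symm⟩
      · exact Set.disjoint_left.1 (hTd hij) ⟨m, rfl⟩ ⟨m', h⟩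
  have hPQ : ∀ i, Disjoint (rayEdges (P i)) (rayEdges (Q j₀)) := by
    intro i
    rw [Set.disjoint_left]
    intro e he hq
    rcases hPe i e he with ⟨m, hm, rfl⟩ | ⟨m, -, rfl⟩
    · exact hQF j₀ _ hq (hFm i i.2 m hm)
    · rcases hTe i _ ⟨m, rfl⟩ with h | ⟨j, hj, h⟩
      · obtain ⟨_ | k, hk⟩ := hq
        · have hv : v ∈ s(T i m, T i (m + 1)) := by
            rw [hk, (hQ j₀).2]; exact Sym2.mem_mk_left _ _
          rcases Sym2.mem_iff.1 hv with hv | hv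
          exacts [(hTv i m).2 hv.symm, (hTv i (m + 1)).2 hv.symm]
        · refine Set.disjoint_left.1 (hJS j₀ hj₀) ⟨k, ?_⟩ h.2
          simpa only [add_comm 1] using hk
      · exact Set.disjoint_left.1 (hQd fun hjj : j = j₀ => hj₀ (hjj ▸ hj))
          (rayEdges_tail_subset _ _ h) hq
  refine ⟨fun i => if h : i < n then P ⟨i, h⟩ else Q j₀, ℓ', by omega, fun i hi => ?_,
    fun i hi j hj hij => ?_, fun i hi m hm => ?_, fun i hi m hm => ?_⟩
  · by_cases h : i < n
    · simp only [h, dif_pos]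
      refine ⟨(hPl _ 0 (Nat.zero_le _)).trans (hR i h).1, hP _, fun m => ?_⟩
      rcases le_total (m + 1) ℓ' with hm | hm
      · rw [hPl _ _ hm]; exact (hR i h).2.2 m
      · obtain ⟨k, hk⟩ := Nat.exists_eq_add_of_le hm
        rw [hk, hPr]; exact (hTv _ _).2
    · simp only [h, dif_neg, not_false_eq_true]
      exact ⟨(hQ j₀).2, (hQr j₀).isLocFinWalk, hQv j₀⟩
  · by_cases h : i < n <;> by_cases h' : j < n
    · simp only [h, h', dif_pos]
      exact hPd _ _ (by simpa using hij)
    · simp only [h, h', dif_pos, dif_neg, not_false_eq_true]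
      exact hPQ _
    · simp only [h, h', dif_pos, dif_neg, not_false_eq_true]
      exact (hPQ _).symm
    · omega
  · by_cases h : i < n
    · simp only [h, dif_pos]
      obtain ⟨k, rfl⟩ := Nat.exists_eq_add_of_le hm
      rw [hPr]; exact (hTv _ _).1
    · simp only [h, dif_neg, not_false_eq_true]
      exact (hQadj j₀ m).2.1
  · simp only [hi, dif_pos]
    exact hPl _ m hm

/-- If `v` starts arbitrarily many edge-disjoint rays even after deleting any finite set of other
vertices, then it starts infinitely many. -/
theorem hasRays_nat_of_delVerts {G : SimpleGraph V} {v : V} {w : ℕ → V}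
    (hw : ∀ x y, G.Adj x y → ∃ k, w k = x)
    (hbig : ∀ D : Set V, D.Finite → v ∉ D → ∀ k, HasRays (delVerts G D) v (Fin k)) :
    HasRays G v ℕ := by
  let D : ℕ → Set V := fun n => {x | x ≠ v ∧ ∃ k < n, w k = x}
  have hD : ∀ n, (D n).Finite := fun n =>
    ((Set.finite_Iio n).image w).subset fun x hx => by
      obtain ⟨-, k, hk, rfl⟩ := hx
      exact ⟨k, hk, rfl⟩
  let Inv : ℕ → (ℕ → ℕ → V) × ℕ → Prop := fun n s =>
    (∀ i < n, s.1 i 0 = v ∧ IsLocFinWalk G (s.1 i) ∧ ∀ m, s.1 i (m + 1) ≠ v) ∧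
    (∀ i < n, ∀ j < n, i ≠ j → Disjoint (rayEdges (s.1 i)) (rayEdges (s.1 j))) ∧
    (∀ i < n, ∀ m ≥ s.2, s.1 i m ∉ D n) ∧ n ≤ s.2
  have step : ∀ n (s : {s // Inv n s}), ∃ s' : {s // Inv (n + 1) s},
      ∀ i < n, ∀ m ≤ s'.1.2, s'.1.1 i m = s.1.1 i m := by
    rintro n ⟨⟨R, ℓ⟩, h1, h2, -, -⟩
    obtain ⟨R', ℓ', h3, h4, h5, h6, h7⟩ := exists_extension (hD (n + 1))
      (hbig (D (n + 1)) (hD (n + 1)) fun h => h.1 rfl) n (n + 1) R h1 h2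
    exact ⟨⟨⟨R', ℓ'⟩, h4, h5, h6, h3⟩, h7⟩
  choose next hnext using step
  let st : ∀ n, {s // Inv n s} := fun n =>
    Nat.rec ⟨⟨fun _ _ => v, 0⟩, by simp [Inv]⟩ next n
  have hst : ∀ n, ∀ i < n, ∀ m ≤ (st (n + 1)).1.2, (st (n + 1)).1.1 i m = (st n).1.1 i m :=
    fun n => hnext n (st n)
  have hlen : ∀ n, n ≤ (st n).1.2 := fun n => (st n).2.2.2.2
  let L : ℕ → ℕ → V := fun i m => (st (i + m + 1)).1.1 i m
  have hL : ∀ i m n, i + m + 1 ≤ n → L i m = (st n).1.1 i m := by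
    intro i m n hn
    induction n, hn using Nat.le_induction with
    | base => rfl
    | succ n hn ih => rw [ih, hst n i (by omega) m ((by omega : m ≤ n + 1).trans (hlen _))]
  have hDmono : ∀ {n n'}, n ≤ n' → D n ⊆ D n' := fun h x hx =>
    ⟨hx.1, hx.2.imp fun k hk => ⟨hk.1.trans_le h, hk.2⟩⟩
  have hav : ∀ n i, i < n → ∀ n' ≥ n, ∀ m ≥ (st n).1.2, (st n').1.1 i m ∉ D n := by
    intro n i hi n' hn' m hm
    induction n', hn' using Nat.le_induction with
    | base => exact (st n).2.2.2.1 i hi m hm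
    | succ n' hn' ih =>
      rcases le_total m (st (n' + 1)).1.2 with h | h
      · rw [hst n' i (by omega) m h]; exact ih
      · exact fun hmem => (st (n' + 1)).2.2.2.1 i (by omega) m h (hDmono (by omega) hmem)
  have hadj : ∀ i m, G.Adj (L i m) (L i (m + 1)) := by
    intro i m
    rw [hL i m (i + m + 2) (by omega), hL i (m + 1) (i + m + 2) (by omega)]
    exact ((st (i + m + 2)).2.1 i (by omega)).2.1.adj m
  refine hasRays_of_isLocFinWalk L (fun i => ⟨⟨hadj i, fun x => ?_⟩, ?_⟩) fun i j hij => ?_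
  · by_cases hx : x = v
    · subst hx
      refine (Set.finite_singleton 0).subset fun m hm => ?_
      obtain _ | m := m
      · rfl
      · exfalso
        have hm : L i (m + 1) = x := hm
        rw [hL i (m + 1) (i + m + 2) (by omega)] at hm
        exact ((st (i + m + 2)).2.1 i (by omega)).2.2 m hm
    · by_cases hk : ∃ k, w k = x
      · obtain ⟨k, rfl⟩ := hk
        refine (Set.finite_lt_nat (st (i + k + 1)).1.2).subset fun m hm => ?_
        by_contra hlt
        have hm : L i m = w k := hm
        rw [hL i m (i + k + m + 1) (by omega)] at hm
        refine hav (i + k + 1) i (by omega) (i + k + m + 1) (by omega) m (not_lt.1 hlt) ?_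
        rw [hm]
        exact ⟨hx, k, by omega, rfl⟩
      · refine Set.finite_empty.subset fun m hm => hk ?_
        exact hw x (L i (m + 1)) ((show L i m = x from hm) ▸ hadj i m)
  · exact ((st (i + 0 + 1)).2.1 i (by omega)).1
  · refine Set.disjoint_left.2 ?_
    rintro e ⟨m, rfl⟩ ⟨l, h⟩
    let n := i + j + m + l + 2
    rw [hL i m n (by omega), hL i (m + 1) n (by omega), hL j l n (by omega),
      hL j (l + 1) n (by omega)] at h
    exact Set.disjoint_left.1 ((st n).2.2.1 i (by omega) j (by omega) hij) ⟨m, rfl⟩ ⟨l, h⟩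

/-- If there is no family of `K` edge-disjoint rays from `v` avoiding `u`, then in any family of
`K + k` edge-disjoint rays from `v`, at least `k` visit `u`. -/
theorem le_card_visits {G : SimpleGraph V} {v u : V} {K k : ℕ}
    (hK : ¬ HasRays (delVerts G {u}) v (Fin K)) {F : Fin (K + k) → ℕ → V}
    (hF : ∀ i, IsRay G (F i) ∧ F i 0 = v)
    (hd : Pairwise fun i j => Disjoint (rayEdges (F i)) (rayEdges (F j))) :
    ∃ s : Finset (Fin (K + k)), k ≤ s.card ∧ ∀ i ∈ s, ∃ m, F i m = u := by
  classical
  refine ⟨Finset.univ.filter fun i => ∃ m, F i m = u, ?_, fun i hi => (Finset.mem_filter.1 hi).2⟩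
  by_contra! hlt
  refine hK (HasRays.of_le_card hd (Finset.univ.filter fun i => ¬ ∃ m, F i m = u)
    (fun i hi => ⟨(hF i).1.delVerts fun n hn => (Finset.mem_filter.1 hi).2 ⟨n, hn⟩, (hF i).2⟩) ?_)
  have h1 := Finset.card_filter_add_card_filter_not (s := (Finset.univ : Finset (Fin (K + k))))
    (fun i => ∃ m, F i m = u)
  simp only [Finset.card_univ, Fintype.card_fin] at h1
  omega

/-- If `v` starts arbitrarily many edge-disjoint rays, but not after deleting `u`, then `u` starts
arbitrarily many edge-disjoint rays avoiding `v`. -/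
theorem HasRays.shift {G : SimpleGraph V} {v u : V} (huv : u ≠ v) (h : ∀ k, HasRays G v (Fin k))
    {K : ℕ} (hK : ¬ HasRays (delVerts G {u}) v (Fin K)) (k : ℕ) :
    HasRays (delVerts G {v}) u (Fin k) := by
  classical
  obtain ⟨F, hF, hd⟩ := h (K + k)
  obtain ⟨s, hs, hu⟩ := le_card_visits hK hF hd
  choose! m hm using hu
  refine HasRays.of_le_card (F := fun i n => F i (m i + n)) (fun i j hij => (hd hij).mono
    (rayEdges_tail_subset _ _) (rayEdges_tail_subset _ _)) s (fun i hi => ⟨?_, hm i hi⟩) hs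
  refine ((hF i).1.tail (m i)).delVerts fun n hn => huv ?_
  have h0 : m i + n = 0 := (hF i).1.1 ((Set.mem_singleton_iff.1 hn).trans (hF i).2.symm)
  rw [← hm i hi, show m i = 0 by omega, (hF i).2]

theorem InfConn.of_hasRays {G : SimpleGraph V} {v u : V} (h : ∀ k, HasRays G v (Fin k))
    {K : ℕ} (hK : ¬ HasRays (delVerts G {u}) v (Fin K)) : InfConn G v u := by
  classical
  intro E hE
  obtain ⟨F, hF, hd⟩ := HasRays.deleteEdges h hE (K + 1)
  obtain ⟨s, hs, hu⟩ := le_card_visits (fun h' => hK (h'.mono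
    (delVerts_mono (SimpleGraph.deleteEdges_le E) _))) hF hd
  obtain ⟨i, hi⟩ := Finset.card_pos.1 hs
  obtain ⟨m, rfl⟩ := hu i hi
  rw [← (hF i).2]
  generalize m = n
  induction n with
  | zero => exact .refl _
  | succ n ih => exact ih.trans ((hF i).1.2 n).reachable

/-- Repeating a nontrivial closed walk forever. -/
theorem exists_periodic {G : SimpleGraph V} {v : V} (c : G.Walk v v) (hc : 0 < c.length) :
    ∃ R : ℕ → V, R 0 = v ∧ (∀ n, G.Adj (R n) (R (n + 1))) ∧ rayEdges R = {e | e ∈ c.edges} := by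
  let R : ℕ → V := fun n => c.getVert (n % c.length)
  have hR : ∀ n, R n = c.getVert (n % c.length) ∧ R (n + 1) = c.getVert (n % c.length + 1) := by
    refine fun n => ⟨rfl, ?_⟩
    have h1 := Nat.mod_lt n hc
    simp only [R, Nat.add_mod n 1]
    by_cases h : n % c.length + 1 = c.length
    · rw [h, c.getVert_length]
      by_cases h' : c.length = 1
      · simp [h', Nat.mod_one]
      · rw [Nat.mod_eq_of_lt (show 1 < c.length by omega), h, Nat.mod_self, c.getVert_zero]
    · rw [Nat.mod_eq_of_lt (show 1 < c.length by omega), Nat.mod_eq_of_lt (by omega)]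
  refine ⟨R, by simp [R], fun n => ?_, ?_⟩
  · rw [(hR n).1, (hR n).2]
    exact c.adj_getVert_succ (Nat.mod_lt n hc)
  · ext e
    induction e using Sym2.ind with
    | _ a b =>
      simp only [Set.mem_ofPred_eq, SimpleGraph.Walk.mk_mem_edges_iff_exists]
      constructor
      · rintro ⟨n, hn⟩
        rw [(hR n).1, (hR n).2] at hn
        exact ⟨_, Nat.mod_lt n hc, hn.symm⟩
      · rintro ⟨n, hn, h⟩
        exact ⟨n, by rw [(hR n).1, (hR n).2, Nat.mod_eq_of_lt hn, h]⟩

/-- If, without the finitely many edges of `F`, each `Q j` is reached infinitely often from `v`,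
then some closed walk at `v` avoids `F` and uses an edge of each of finitely many `Q j`. -/
theorem exists_closed_walk {G : SimpleGraph V} {v : V} {ι : Type*} {Q : ι → ℕ → V}
    (hQ : ∀ j, IsLocFinWalk G (Q j)) {F : Set (Sym2 V)} (hF : F.Finite)
    (h : ∀ j M, ∃ m ≥ M, (G.deleteEdges F).Reachable v (Q j m)) (s : Finset ι) :
    ∃ c : (G.deleteEdges F).Walk v v, ∀ j ∈ s, ∃ e ∈ c.edges, e ∈ rayEdges (Q j) := by
  classical
  induction s using Finset.induction_on with
  | empty => exact ⟨.nil, by simp⟩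
  | insert j s _ ih =>
    obtain ⟨c, hc⟩ := ih
    have hfin : {m | s(Q j m, Q j (m + 1)) ∈ F}.Finite := by
      refine (hF.biUnion fun e _ => (hQ j).finite_edge_visits e).subset fun m hm => ?_
      exact Set.mem_biUnion hm rfl
    obtain ⟨M, hM⟩ := hfin.bddAbove
    obtain ⟨m, hm, ⟨p⟩⟩ := h j (M + 1)
    have hadj : (G.deleteEdges F).Adj (Q j m) (Q j (m + 1)) :=
      SimpleGraph.deleteEdges_adj.2 ⟨(hQ j).adj m, fun hmF => by
        have : m ≤ M := hM hmF
        omega⟩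
    refine ⟨c.append ((p.append (.cons hadj (.cons hadj.symm .nil))).append p.reverse), ?_⟩
    intro i hi
    rcases Finset.mem_insert.1 hi with rfl | hi
    · exact ⟨s(Q i m, Q i (m + 1)), by simp [SimpleGraph.Walk.edges_append], mem_rayEdges _ _⟩
    · obtain ⟨e, he, he'⟩ := hc i hi
      exact ⟨e, by simp [SimpleGraph.Walk.edges_append, he], he'⟩

/-- If every `Q j` is reached infinitely often from `v` after removing any finite set of edges, then
`v` starts as many edge-disjoint rays as there are walks `Q j`. -/
theorem hasRays_of_infinitely_reachable {G : SimpleGraph V} {v : V} {K : ℕ}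
    {Q : Fin K → ℕ → V} (hQ : ∀ j, IsLocFinWalk G (Q j))
    (hQd : Pairwise fun i j => Disjoint (rayEdges (Q i)) (rayEdges (Q j)))
    (h : ∀ j, ∀ F : Set (Sym2 V), F.Finite → ∀ M, ∃ m ≥ M,
      (G.deleteEdges F).Reachable v (Q j m)) : HasRays G v (Fin K) := by
  classical
  rcases K.eq_zero_or_pos with rfl | hK
  · exact ⟨Fin.elim0, fun i => i.elim0, fun i => i.elim0⟩
  obtain ⟨c, hc, hcd⟩ := exists_seq_of_forall_list
    (fun (_ : ℕ) (c : G.Walk v v) => ∀ j, ∃ e ∈ c.edges, e ∈ rayEdges (Q j))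
    (fun c c' => ∀ e ∈ c.edges, e ∉ c'.edges) (by
      intro _ s _
      have hF : {e | ∃ c ∈ s, e ∈ c.edges}.Finite := by
        have : {e | ∃ c ∈ s, e ∈ c.edges} = ⋃ c ∈ {c | c ∈ s}, {e | e ∈ c.edges} := by
          ext; simp
        rw [this]
        exact (List.finite_toSet s).biUnion fun c _ => List.finite_toSet c.edges
      obtain ⟨c, hc⟩ := exists_closed_walk hQ hF (fun j => h j _ hF) Finset.univ
      refine ⟨c.mapLe (SimpleGraph.deleteEdges_le _), fun j => ?_, fun d hd e he hec => ?_⟩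
      · simpa only [SimpleGraph.Walk.edges_mapLe_eq_edges] using hc j (Finset.mem_univ j)
      · rw [SimpleGraph.Walk.edges_mapLe_eq_edges] at hec
        have := c.edges_subset_edgeSet hec
        rw [SimpleGraph.edgeSet_deleteEdges] at this
        exact this.2 ⟨d, hd, he⟩)
  have hlen : ∀ n, 0 < (c n).length := fun n => by
    obtain ⟨e, he, -⟩ := hc n ⟨0, hK⟩
    rw [← SimpleGraph.Walk.length_edges]
    exact List.length_pos_of_mem he
  choose R hR0 hR hRe using fun n => exists_periodic (c n) (hlen n)
  have hRd : ∀ m n, m ≠ n → Disjoint (rayEdges (R m)) (rayEdges (R n)) := by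
    intro m n hmn
    rw [hRe, hRe, Set.disjoint_left]
    intro e h1 h2
    rcases lt_or_gt_of_ne hmn with hlt | hlt
    exacts [hcd m n hlt e h1 h2, hcd n m hlt e h2 h1]
  obtain ⟨S, J, T, -, hJS, hTd, hT⟩ := exists_linkage (G := G) (fun i : Fin K => R i) Q
    (fun i => hR i) (fun i j hij => hRd i j (Fin.val_ne_of_ne hij)) hQ hQd
  refine hasRays_of_isLocFinWalk T (fun i => ⟨?_, (hT i).1.trans (hR0 i)⟩) hTd
  rcases (hT i).2.2 with hi | ⟨-, hi, hJ⟩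
  · exact hi
  · exfalso
    obtain ⟨j, hj⟩ : ∃ j, j ∉ J := by
      by_contra! hall
      rw [Finset.eq_univ_iff_forall.2 hall] at hJ
      simp at hJ
    obtain ⟨e, he, hej⟩ := hc i j
    refine Set.disjoint_left.1 (hJS j hj) hej (hi ?_)
    rw [hRe]
    exact he

theorem finite_edges {G : SimpleGraph V} {a b : V} (p : G.Walk a b) : {e | e ∈ p.edges}.Finite :=
  List.finite_toSet _

/-- Infinitely many edge-disjoint rays from `u` can be shifted to `v` along infinitely many
edge-disjoint paths, unless `v` starts arbitrarily many edge-disjoint rays avoiding `u`. -/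
theorem HasRays.nat_of_infConn {G : SimpleGraph V} {v u : V} {K : ℕ}
    (hK : ¬ HasRays (delVerts G {u}) v (Fin K)) (hvu : InfConn G v u)
    (h : HasRays (delVerts G {v}) u ℕ) : HasRays G v ℕ := by
  classical
  obtain ⟨R, hR, hRd⟩ := h
  have hRr : ∀ i, IsRay G (R i) := fun i => (hR i).1.mono (delVerts_le _ _)
  have hRu : ∀ i m, R i (m + 1) ≠ u := fun i m hm => by
    simpa using (hRr i).1 (hm.trans (hR i).2.symm)
  let Bad : Set ℕ := {i | ∀ F : Set (Sym2 V), F.Finite → ∀ M, ∃ m ≥ M,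
    ((delVerts G {u}).deleteEdges F).Reachable v (R i (1 + m))}
  have hBad : Bad.Finite := by
    by_contra hinf
    have e := Set.Infinite.natEmbedding Bad hinf
    refine hK (hasRays_of_infinitely_reachable (Q := fun (j : Fin K) m => R (e j) (1 + m))
      (fun j => ?_) (fun i j hij => ?_) fun j F hF M => (e j).2 F hF M)
    · refine (((hRr (e j)).tail 1).delVerts fun n => ?_).isLocFinWalk
      rw [Set.mem_singleton_iff, add_comm 1]
      exact hRu (e j) n
    · refine (hRd fun h' => hij ?_).mono (rayEdges_tail_subset _ _) (rayEdges_tail_subset _ _)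
      exact Fin.val_injective (e.injective (Subtype.val_injective h'))
  have hGood : ∀ i, i ∉ Bad → ∃ F : Set (Sym2 V), F.Finite ∧ ∀ p : G.Walk v u, p.IsPath →
      (∀ e ∈ p.edges, e ∉ F) → ∀ e ∈ p.edges, e ∉ rayEdges (R i) := by
    intro i hi
    simp only [Bad, Set.mem_ofPred_eq, not_forall] at hi
    obtain ⟨F, hF, M, hM⟩ := hi
    refine ⟨F ∪ (fun m => s(R i m, R i (m + 1))) '' Set.Iio (M + 1),
      hF.union ((Set.finite_Iio _).image _), fun p hp hpF e he => ?_⟩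
    rintro ⟨m, rfl⟩
    have hm : M + 1 ≤ m := by
      by_contra! hlt
      exact hpF _ he (Or.inr ⟨m, hlt, rfl⟩)
    have hz : R i m ∈ p.support := p.fst_mem_support_of_mem_edges he
    obtain ⟨k, rfl⟩ := Nat.exists_eq_add_of_le' (by omega : 1 ≤ m)
    refine hM ⟨k, by omega, ?_⟩
    rw [add_comm 1 k]
    refine ⟨(p.takeUntil _ hz).transfer _ fun e he' => ?_⟩
    have hu := SimpleGraph.Walk.endpoint_notMem_support_takeUntil hp hz (hRu i k).symm
    have heF : e ∉ F := fun h' => hpF e (p.edges_takeUntil_subset_edges hz he') (Or.inl h')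
    have heG := (p.takeUntil _ hz).edges_subset_edgeSet he'
    induction e using Sym2.ind with
    | _ a b =>
      refine SimpleGraph.deleteEdges_adj.2 ⟨⟨heG, ?_, ?_⟩, heF⟩
      · rintro rfl
        exact hu (SimpleGraph.Walk.fst_mem_support_of_mem_edges _ he')
      · rintro rfl
        exact hu (SimpleGraph.Walk.snd_mem_support_of_mem_edges _ he')
  choose! E hE hEp using hGood
  obtain ⟨x, hx, hxd⟩ := exists_seq_of_forall_list
    (fun (_ : ℕ) (x : G.Walk v u × ℕ) => x.2 ∉ Bad ∧ Disjoint (rayEdges (R x.2)) {e | e ∈ x.1.edges})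
    (fun x y => x.2 ≠ y.2 ∧ Disjoint {e | e ∈ x.1.edges} {e | e ∈ y.1.edges} ∧
      Disjoint (rayEdges (R x.2)) {e | e ∈ y.1.edges} ∧
      Disjoint (rayEdges (R y.2)) {e | e ∈ x.1.edges}) (by
    intro _ s hs
    have hF : (⋃ x ∈ {x | x ∈ s}, ({e | e ∈ x.1.edges} ∪ E x.2)).Finite :=
      (List.finite_toSet s).biUnion fun x hx =>
        (finite_edges x.1).union (hE _ (hs x hx).choose_spec.1)
    obtain ⟨q, hq⟩ := (hvu _ hF).exists_isPath
    obtain ⟨p, hp, hpF⟩ : ∃ p : G.Walk v u, p.IsPath ∧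
        ∀ e ∈ p.edges, ∀ x ∈ s, e ∉ x.1.edges ∧ e ∉ E x.2 := by
      refine ⟨q.mapLe (SimpleGraph.deleteEdges_le _), hq.mapLe _, fun e he x hx => ?_⟩
      rw [SimpleGraph.Walk.edges_mapLe_eq_edges] at he
      have he' := q.edges_subset_edgeSet he
      rw [SimpleGraph.edgeSet_deleteEdges] at he'
      exact not_or.1 fun h' => he'.2 (Set.mem_biUnion (show x ∈ {x | x ∈ s} from hx) h')
    have hX : (Bad ∪ {i | ∃ x ∈ s, x.2 = i} ∪ {i | ¬ Disjoint (rayEdges (R i)) {e | e ∈ p.edges}} ∪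
        ⋃ x ∈ {x | x ∈ s}, {i | ¬ Disjoint (rayEdges (R i)) {e | e ∈ x.1.edges}}).Finite :=
      ((hBad.union ((List.finite_toSet s).image Prod.snd)).union
        (ncard_not_disjoint_le hRd (finite_edges p)).1).union
        ((List.finite_toSet s).biUnion fun x _ => (ncard_not_disjoint_le hRd (finite_edges x.1)).1)
    obtain ⟨i, hi⟩ := hX.exists_notMem
    simp only [Set.mem_union, Set.mem_iUnion, Set.mem_ofPred_eq, not_or, not_exists,
      not_not, not_and] at hi
    obtain ⟨⟨⟨hi1, hi2⟩, hi3⟩, hi4⟩ := hi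
    refine ⟨(p, i), ⟨hi1, hi3⟩, fun x hx => ⟨hi2 x hx, ?_, ?_, hi4 x hx⟩⟩
    · exact Set.disjoint_left.2 fun e h1 h2 => (hpF e h2 x hx).1 h1
    · exact Set.disjoint_left.2 fun e h1 h2 => hEp x.2 (hs x hx).choose_spec.1 p hp
        (fun e he => (hpF e he x hx).2) e h2 h1)
  choose T hT hT0 hTr hTe using fun n => IsLocFinWalk.splice (G := G) (f := (x n).1.getVert)
    (a := (x n).1.length) (b := 0) (fun m hm => (x n).1.adj_getVert_succ hm)
    (hRr (x n).2).isLocFinWalk (by simp [(hR _).2])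
  have hTsub : ∀ n, rayEdges (T n) ⊆ {e | e ∈ (x n).1.edges} ∪ rayEdges (R (x n).2) := by
    intro n e he
    rcases hTe n e he with ⟨m, hm, rfl⟩ | ⟨m, -, rfl⟩
    · exact Or.inl ((SimpleGraph.Walk.mk_mem_edges_iff_exists _).2 ⟨m, hm, rfl⟩)
    · exact Or.inr ⟨m, rfl⟩
  have hTd : ∀ m n, m < n → Disjoint (rayEdges (T m)) (rayEdges (T n)) := by
    intro m n hmn
    obtain ⟨h1, h2, h3, h4⟩ := hxd m n hmn
    refine Disjoint.mono (hTsub m) (hTsub n) ?_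
    rw [Set.disjoint_union_left, Set.disjoint_union_right, Set.disjoint_union_right]
    exact ⟨⟨h2, h4.symm⟩, h3, hRd h1⟩
  refine hasRays_of_isLocFinWalk T (fun n => ⟨hT n, (hT0 n 0 (Nat.zero_le _)).trans (by simp)⟩)
    fun m n hmn => ?_
  rcases lt_or_gt_of_ne hmn with hlt | hlt
  exacts [hTd m n hlt, (hTd n m hlt).symm]

/-- Concatenating infinitely many finite walks gives a locally finite walk, if every vertex is on
only finitely many of them. -/
theorem exists_concat {G : SimpleGraph V} {c : ℕ → V} (p : ∀ j, G.Walk (c j) (c (j + 1)))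
    (hp : ∀ j, 0 < (p j).length) (hfin : ∀ x, ∃ J, ∀ j ≥ J, ∀ e ∈ (p j).edges, x ∉ e) :
    ∃ f, IsLocFinWalk G f ∧ f 0 = c 0 ∧ ∀ e ∈ rayEdges f, ∃ j, e ∈ (p j).edges := by
  let next : ℕ × ℕ → ℕ × ℕ := fun s =>
    if s.2 + 1 < (p s.1).length then (s.1, s.2 + 1) else (s.1 + 1, 0)
  let st : ℕ → ℕ × ℕ := fun n => Nat.rec (0, 0) (fun _ => next) n
  have hst : ∀ n, (st n).2 < (p (st n).1).length := by
    intro n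
    induction n with
    | zero => exact hp 0
    | succ n _ =>
      change (next (st n)).2 < (p (next (st n)).1).length
      by_cases h : (st n).2 + 1 < (p (st n).1).length
      · rwa [show next (st n) = _ from if_pos h]
      · rw [show next (st n) = _ from if_neg h]
        exact hp _
  have hinj : Function.Injective st := by
    have : StrictMono fun n => toLex (st n) := by
      refine strictMono_nat_of_lt_succ fun n => ?_
      change toLex (st n) < toLex (next (st n))
      rw [Prod.Lex.toLex_lt_toLex]
      by_cases h : (st n).2 + 1 < (p (st n).1).length
      · simp [next, h]
      · simp [next, h]
    exact fun m n hmn => this.injective (congrArg toLex hmn)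
  let f : ℕ → V := fun n => (p (st n).1).getVert (st n).2
  have hsucc : ∀ n, f (n + 1) = (p (st n).1).getVert ((st n).2 + 1) := by
    intro n
    change (p (next (st n)).1).getVert (next (st n)).2 = _
    have := hst n
    by_cases h : (st n).2 + 1 < (p (st n).1).length
    · rw [show next (st n) = _ from if_pos h]
    · rw [show next (st n) = _ from if_neg h, SimpleGraph.Walk.getVert_zero, show (st n).2 + 1 = (p (st n).1).length by omega, SimpleGraph.Walk.getVert_length]
  have hedge : ∀ n, s(f n, f (n + 1)) ∈ (p (st n).1).edges := fun n => by
    rw [hsucc]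
    exact (SimpleGraph.Walk.mk_mem_edges_iff_exists _).2 ⟨_, hst n, rfl⟩
  refine ⟨f, ⟨fun n => (p (st n).1).edges_subset_edgeSet (hedge n), fun x => ?_⟩,
    (p 0).getVert_zero, ?_⟩
  · obtain ⟨J, hJ⟩ := hfin x
    have hS : (⋃ j ∈ Set.Iio J, (fun k => (j, k)) '' Set.Iio (p j).length).Finite :=
      (Set.finite_Iio J).biUnion fun j _ => (Set.finite_Iio _).image _
    refine (hS.preimage hinj.injOn).subset fun n hn => ?_
    have hlt : (st n).1 < J := by
      by_contra! hge
      refine hJ _ hge _ (hedge n) ?_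
      rw [show f n = x from hn]
      exact Sym2.mem_mk_left _ _
    exact Set.mem_biUnion (show (st n).1 ∈ Set.Iio J from hlt) ⟨(st n).2, hst n, rfl⟩
  · rintro e ⟨n, rfl⟩
    exact ⟨_, hedge n⟩

/-- A chain of vertices, consecutive ones not separated by finitely many edges in graphs that
eventually leave every vertex, yields infinitely many edge-disjoint rays. -/
theorem hasRays_nat_of_chain {H : ℕ → SimpleGraph V} {c : ℕ → V} (hH : Antitone H)
    (hc : ∀ j, c j ≠ c (j + 1)) (hconn : ∀ j, InfConn (H j) (c j) (c (j + 1)))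
    (hfin : ∀ x, ∃ J, ∀ j ≥ J, ∀ y, ¬ (H j).Adj x y) : HasRays (H 0) (c 0) ℕ := by
  obtain ⟨E, hE, hEd⟩ := exists_seq_of_forall_list
    (fun t (E : Set (Sym2 V)) => E.Finite ∧ E ⊆ (H t.unpair.2).edgeSet ∧
      ∃ p : (H 0).Walk (c t.unpair.2) (c (t.unpair.2 + 1)), ∀ e ∈ p.edges, e ∈ E)
    (fun E E' => Disjoint E E') (by
    intro t s hs
    have hF : (⋃ E ∈ {E | E ∈ s}, E).Finite :=
      (List.finite_toSet s).biUnion fun E hEs => (hs E hEs).choose_spec.1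
    obtain ⟨p⟩ := hconn t.unpair.2 _ hF
    refine ⟨{e | e ∈ p.edges}, ⟨List.finite_toSet _, fun e he => ?_,
      p.mapLe ((SimpleGraph.deleteEdges_le _).trans (hH (Nat.zero_le _))), fun e he => ?_⟩,
      fun E hEs => Set.disjoint_right.2 fun e he heE => ?_⟩
    · exact SimpleGraph.edgeSet_mono (SimpleGraph.deleteEdges_le _) (p.edges_subset_edgeSet he)
    · rwa [SimpleGraph.Walk.edges_mapLe_eq_edges] at he
    · have he' := p.edges_subset_edgeSet he
      rw [SimpleGraph.edgeSet_deleteEdges] at he'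
      exact he'.2 (Set.mem_biUnion (show E ∈ {E | E ∈ s} from hEs) heE))
  have hp : ∀ i j, E (Nat.pair i j) ⊆ (H j).edgeSet ∧
      ∃ p : (H 0).Walk (c j) (c (j + 1)), ∀ e ∈ p.edges, e ∈ E (Nat.pair i j) := fun i j => by
    have h := (hE (Nat.pair i j)).2
    rwa [Nat.unpair_pair] at h
  choose hEH p hpE using hp
  have hdisj : ∀ m n, m ≠ n → Disjoint (E m) (E n) := by
    intro m n hmn
    rcases lt_or_gt_of_ne hmn with hlt | hlt
    exacts [hEd m n hlt, (hEd n m hlt).symm]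
  choose f hf hf0 hfe using fun i => exists_concat (p i)
    (fun j => by
      by_contra h
      exact hc j (SimpleGraph.Walk.eq_of_length_eq_zero (p := p i j) (by omega)))
    (fun x => by
      obtain ⟨J, hJ⟩ := hfin x
      refine ⟨J, fun j hj e he hxe => ?_⟩
      obtain ⟨y, rfl⟩ := hxe
      exact hJ j hj y (hEH i j (hpE i j _ he)))
  refine hasRays_of_isLocFinWalk f (fun i => ⟨hf i, hf0 i⟩) fun i i' hii => ?_
  refine Set.disjoint_left.2 fun e he he' => ?_
  obtain ⟨j, hj⟩ := hfe i e he
  obtain ⟨j', hj'⟩ := hfe i' e he'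
  refine Set.disjoint_left.1 (hdisj _ _ fun h => hii ?_) (hpE i j e hj) (hpE i' j' e hj')
  exact (Nat.pair_eq_pair.1 h).1

/-- From a vertex starting arbitrarily many but not infinitely many edge-disjoint rays, one can move
on to another such vertex while deleting a prescribed vertex. -/
theorem exists_step {H : SimpleGraph V} {c : V} {w : ℕ → V}
    (hw : ∀ x y, H.Adj x y → ∃ k, w k = x) (hbig : ∀ k, HasRays H c (Fin k))
    (hno : ¬ HasRays H c ℕ) (n : ℕ) :
    ∃ (H' : SimpleGraph V) (c' : V), (∀ k, HasRays H' c' (Fin k)) ∧ ¬ HasRays H' c' ℕ ∧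
      H' ≤ delVerts H {c} ∧ c ≠ c' ∧ InfConn H c c' ∧ (H' ≤ delVerts H {w n} ∨ c' = w n) := by
  have key : ∀ H₁ ≤ H, ∀ u, u ≠ c → (∀ k, HasRays H₁ c (Fin k)) →
      (¬ ∀ k, HasRays (delVerts H₁ {u}) c (Fin k)) →
      (∀ k, HasRays (delVerts H₁ {c}) u (Fin k)) ∧ ¬ HasRays (delVerts H₁ {c}) u ℕ ∧
      delVerts H₁ {c} ≤ delVerts H {c} ∧ c ≠ u ∧ InfConn H c u := by
    intro H₁ hH u hu hb hK
    obtain ⟨K, hK⟩ := not_forall.1 hK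
    have hconn := InfConn.of_hasRays hb hK
    exact ⟨HasRays.shift hu hb hK, fun h => hno ((HasRays.nat_of_infConn hK hconn h).mono hH),
      delVerts_mono hH _, hu.symm,
      fun F hF => (hconn F hF).mono (SimpleGraph.deleteEdges_mono hH)⟩
  by_cases hwc : w n ≠ c ∧ ¬ ∀ k, HasRays (delVerts H {w n}) c (Fin k)
  · obtain ⟨h1, h2, h3, h4, h5⟩ := key H le_rfl (w n) hwc.1 hbig hwc.2
    exact ⟨_, _, h1, h2, h3, h4, h5, Or.inr rfl⟩
  obtain ⟨H₁, hH₁, hb₁, hn₁⟩ : ∃ H₁ ≤ H, (∀ k, HasRays H₁ c (Fin k)) ∧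
      delVerts H₁ {c} ≤ delVerts H {w n} := by
    by_cases h : w n = c
    · exact ⟨H, le_rfl, hbig, by rw [h]⟩
    · exact ⟨delVerts H {w n}, delVerts_le _ _, by tauto, delVerts_le _ _⟩
  obtain ⟨D, u, hu, hD, hDu⟩ : ∃ (D : Set V) (u : V), u ≠ c ∧
      (∀ k, HasRays (delVerts H₁ D) c (Fin k)) ∧
      ¬ ∀ k, HasRays (delVerts (delVerts H₁ D) {u}) c (Fin k) := by
    by_contra! hall
    refine hno (HasRays.mono hH₁ (hasRays_nat_of_delVerts
      (fun x y hxy => hw x y (hH₁ hxy)) fun D hD => ?_))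
    induction D, hD using Set.Finite.induction_on with
    | empty =>
      intro _ k
      obtain ⟨F, hF, hd⟩ := hb₁ k
      exact ⟨F, fun i => ⟨(hF i).1.delVerts fun _ => Set.notMem_empty _, (hF i).2⟩, hd⟩
    | @insert u D _ _ ih =>
      intro hc k
      rw [delVerts_insert]
      rw [Set.mem_insert_iff, not_or] at hc
      exact hall D u (Ne.symm hc.1) (ih hc.2) k
  obtain ⟨h1, h2, h3, h4, h5⟩ := key _ ((delVerts_le H₁ D).trans hH₁) u hu hD hDu
  exact ⟨_, _, h1, h2, h3, h4, h5, Or.inl ((delVerts_mono (delVerts_le H₁ D) _).trans hn₁)⟩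

/-- The countable case of the theorem. -/
theorem hasRays_nat_of_countable {G : SimpleGraph V} {v : V} {w : ℕ → V}
    (hw : ∀ x y, G.Adj x y → ∃ k, w k = x) (h : ∀ k, HasRays G v (Fin k)) : HasRays G v ℕ := by
  by_contra hno
  let α := {s : SimpleGraph V × V // s.1 ≤ G ∧ (∀ k, HasRays s.1 s.2 (Fin k)) ∧ ¬ HasRays s.1 s.2 ℕ}
  have step : ∀ n (s : α), ∃ s' : α, s'.1.1 ≤ delVerts s.1.1 {s.1.2} ∧ s.1.2 ≠ s'.1.2 ∧
      InfConn s.1.1 s.1.2 s'.1.2 ∧ (s'.1.1 ≤ delVerts s.1.1 {w n} ∨ s'.1.2 = w n) := by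
    rintro n ⟨⟨H, c⟩, hH, hb, hn⟩
    obtain ⟨H', c', h1, h2, h3, h4⟩ :=
      exists_step (fun x y hxy => hw x y (hH hxy)) hb hn n
    exact ⟨⟨⟨H', c'⟩, (h3.trans (delVerts_le _ _)).trans hH, h1, h2⟩, h3, h4⟩
  choose next h1 h2 h3 h4 using step
  let st : ℕ → α := fun n => Nat.rec ⟨(G, v), le_rfl, h, hno⟩ next n
  have hanti : Antitone fun n => (st n).1.1 :=
    antitone_nat_of_succ_le fun n => (h1 n (st n)).trans (delVerts_le _ _)
  refine hno (hasRays_nat_of_chain (H := fun n => (st n).1.1) (c := fun n => (st n).1.2)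
    hanti (fun n => h2 n (st n)) (fun n => h3 n (st n)) fun x => ?_)
  by_cases hx : ∃ k, w k = x
  · obtain ⟨k, rfl⟩ := hx
    refine ⟨k + 2, fun j hj y hxy => ?_⟩
    have hadj : (st (k + 2)).1.1.Adj (w k) y := hanti hj hxy
    have hdel := h1 (k + 1) (st (k + 1)) hadj
    rcases h4 k (st k) with h5 | h5
    · exact (h5 hdel.1).2.1 rfl
    · exact hdel.2.1 h5.symm
  · exact ⟨0, fun j _ y hxy => hx (hw x y ((st j).2.1 hxy))⟩

/-- If `G` contains, for every `k`, a family of `k` pairwise edge-disjoint rays all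
starting at `v`, then it contains an infinite such family. -/
theorem stmt_1 (G : SimpleGraph V) (v : V)
    (h : ∀ k : ℕ, ∃ F : Fin k → ℕ → V, (∀ i, IsRay G (F i) ∧ F i 0 = v) ∧
      Pairwise fun i j => Disjoint (rayEdges (F i)) (rayEdges (F j))) :
    ∃ F : ℕ → ℕ → V, (∀ i, IsRay G (F i) ∧ F i 0 = v) ∧
      Pairwise fun i j => Disjoint (rayEdges (F i)) (rayEdges (F j)) := by
  choose F hF hd using h
  have hC : (insert v (⋃ (k : ℕ) (i : Fin k), Set.range (F k i))).Countable :=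
    (Set.countable_iUnion fun k => Set.countable_iUnion fun i => Set.countable_range _).insert v
  obtain ⟨w, hw⟩ := hC.exists_eq_range ⟨v, Set.mem_insert _ _⟩
  refine HasRays.mono (delVerts_le G (Set.range w)ᶜ) (hasRays_nat_of_countable (w := w)
    (fun x y hxy => not_not.1 hxy.2.1) fun k => ⟨F k, fun i => ⟨?_, (hF k i).2⟩, hd k⟩)
  refine (hF k i).1.delVerts fun n hn => hn ?_
  rw [← hw]
  exact Or.inr (Set.mem_iUnion₂.2 ⟨k, i, n, rfl⟩)
end

section
/- Let G be a locally finite connected graph with an end ω of finite vertex-degree. Then there exists a sequence of separations ((A_i, B_i))_{i ∈ ℕ} of G capturing ω, i.e. satisfying: A_i ∩ B_{i+1} = ∅ for all i; A_{i+1} ∩ B_i is connected for all i; the union of all A_i is G; each separation (A_i, B_i) has order equal to the vertex-degree of ω; and each B_i contains a ray of ω. -/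
open SimpleGraph

variable {V : Type*}

namespace EndSeparation

/-- The vertices outside `C` with a neighbour in `C`. -/
def boundary (G : SimpleGraph V) (C : Set V) : Set V := {v | v ∉ C ∧ ∃ u ∈ C, G.Adj u v}

/-- `C` is connected: it has no proper nonempty subset closed under adjacency in `C`. -/
def IsConn (G : SimpleGraph V) (C : Set V) : Prop :=
  ∀ U ⊆ C, U.Nonempty → (∀ u ∈ U, ∀ v ∈ C, G.Adj u v → v ∈ U) → U = C

/-- `C` has finite boundary and contains a tail of the sequence `W`. -/
def IsRegion (G : SimpleGraph V) (W : ℕ → V) (C : Set V) : Prop :=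
  (boundary G C).Finite ∧ ∃ t, ∀ i, t ≤ i → W i ∈ C

/-- A connected region whose boundary is smallest among the regions inside it. -/
def IsTight (G : SimpleGraph V) (W : ℕ → V) (C : Set V) : Prop :=
  IsConn G C ∧ IsRegion G W C ∧
    ∀ D ⊆ C, IsRegion G W D → (boundary G C).ncard ≤ (boundary G D).ncard

variable {G : SimpleGraph V} {W : ℕ → V} {C D : Set V}

lemma IsConn.exists_walk (hC : IsConn G C) {u v : V} (hu : u ∈ C) (hv : v ∈ C) :
    ∃ w : G.Walk u v, ∀ x ∈ w.support, x ∈ C := by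
  have h : {x | x ∈ C ∧ ∃ w : G.Walk u x, ∀ y ∈ w.support, y ∈ C} = C := by
    refine hC _ (fun x hx => hx.1) ⟨u, hu, .nil, by simpa using hu⟩ ?_
    rintro x ⟨hx, w, hw⟩ y hy hxy
    refine ⟨hy, w.concat hxy, fun z hz => ?_⟩
    rw [Walk.support_concat, List.mem_append, List.mem_singleton] at hz
    rcases hz with hz | rfl
    exacts [hw z hz, hy]
  exact (h.symm ▸ hv : v ∈ {x | x ∈ C ∧ ∃ w : G.Walk u x, ∀ y ∈ w.support, y ∈ C}).2

lemma IsConn.subset_of_mem (hC : IsConn G C) (h : Disjoint C (boundary G D)) {x : V}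
    (hxC : x ∈ C) (hxD : x ∈ D) : C ⊆ D := by
  have : C ∩ D = C := by
    refine hC _ Set.inter_subset_left ⟨x, hxC, hxD⟩ fun u hu v hv huv => ⟨hv, ?_⟩
    by_contra hvD
    exact Set.disjoint_left.1 h hv ⟨hvD, u, hu.2, huv⟩
  exact Set.inter_eq_left.1 this

lemma IsConn.union (hC : IsConn G C) (hD : IsConn G D) {x : V} (hxC : x ∈ C) (hxD : x ∈ D) :
    IsConn G (C ∪ D) := by
  intro U hU hne hcl
  have key : ∀ E ⊆ C ∪ D, IsConn G E → (U ∩ E).Nonempty → E ⊆ U := by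
    intro E hE hEc hn
    exact Set.inter_eq_right.1
      (hEc _ Set.inter_subset_right hn fun u hu v hv huv => ⟨hcl u hu.1 v (hE hv) huv, hv⟩)
  have hxU : x ∈ U := by
    obtain ⟨u, hu⟩ := hne
    rcases hU hu with h | h
    · exact key C Set.subset_union_left hC ⟨u, hu, h⟩ hxC
    · exact key D Set.subset_union_right hD ⟨u, hu, h⟩ hxD
  exact hU.antisymm (Set.union_subset (key C Set.subset_union_left hC ⟨x, hxU, hxC⟩)
    (key D Set.subset_union_right hD ⟨x, hxU, hxD⟩))

lemma isConn_singleton (x : V) : IsConn G {x} := by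
  intro U hU hne _
  exact (Set.subset_singleton_iff_eq.1 hU).resolve_left hne.ne_empty

lemma IsConn.insert_of_adj (hC : IsConn G C) {x y : V} (hx : x ∈ C) (hxy : G.Adj x y) :
    IsConn G (insert y C) := by
  have hpair : IsConn G {x, y} := by
    intro U hU hne hcl
    have hor : x ∈ U ∨ y ∈ U := by
      obtain ⟨u, hu⟩ := hne
      rcases hU hu with rfl | rfl
      exacts [.inl hu, .inr hu]
    refine hU.antisymm ?_
    rintro z (rfl | rfl)
    · exact hor.elim id fun h => hcl _ h _ (by simp) hxy.symm
    · exact hor.elim (fun h => hcl _ h _ (by simp) hxy) id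
  have := hC.union hpair hx (by simp)
  rwa [show C ∪ {x, y} = insert y C by
    ext z; simp only [Set.mem_union, Set.mem_insert_iff, Set.mem_singleton_iff]
    constructor
    · rintro (h | rfl | rfl)
      exacts [.inr h, .inr hx, .inl rfl]
    · tauto] at this

lemma IsConn.exists_finite_isConn (hC : IsConn G C) {x : V} (hx : x ∈ C) {F : Set V}
    (hF : F.Finite) (hFC : F ⊆ C) :
    ∃ Y ⊆ C, Y.Finite ∧ IsConn G Y ∧ x ∈ Y ∧ F ⊆ Y := by
  have hpt : {v | v ∈ C ∧ ∃ Y ⊆ C, Y.Finite ∧ IsConn G Y ∧ x ∈ Y ∧ v ∈ Y} = C := by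
    refine hC _ (fun v hv => hv.1)
      ⟨x, hx, {x}, by simpa using hx, Set.finite_singleton x, isConn_singleton x, rfl, rfl⟩ ?_
    rintro u ⟨-, Y, hYC, hYf, hY, hxY, huY⟩ v hv huv
    exact ⟨hv, insert v Y, Set.insert_subset hv hYC, hYf.insert v, hY.insert_of_adj huY huv,
      Set.mem_insert_of_mem v hxY, Set.mem_insert v Y⟩
  induction F, hF using Set.Finite.induction_on with
  | empty => exact ⟨{x}, by simpa using hx, Set.finite_singleton x, isConn_singleton x, rfl,
      Set.empty_subset _⟩
  | @insert v F _ _ ih =>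
    obtain ⟨Y, hYC, hYf, hY, hxY, hFY⟩ := ih ((Set.subset_insert _ _).trans hFC)
    have hv : v ∈ C := hFC (Set.mem_insert v F)
    rw [← hpt] at hv
    obtain ⟨-, Z, hZC, hZf, hZ, hxZ, hvZ⟩ := hv
    exact ⟨Y ∪ Z, Set.union_subset hYC hZC, hYf.union hZf, hY.union hZ hxY hxZ, .inl hxY,
      Set.insert_subset (.inr hvZ) (hFY.trans Set.subset_union_left)⟩

lemma IsRegion.exists_isConn (hW : IsRay G W) (hD : IsRegion G W D) :
    ∃ C ⊆ D, IsConn G C ∧ IsRegion G W C ∧ boundary G C ⊆ boundary G D := by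
  obtain ⟨hfin, t, ht⟩ := hD
  let 𝒰 : Set (Set V) := {U | U ⊆ D ∧ W t ∈ U ∧ ∀ u ∈ U, ∀ v ∈ D, G.Adj u v → v ∈ U}
  have hD𝒰 : D ∈ 𝒰 := ⟨subset_rfl, ht t le_rfl, fun _ _ v hv _ => hv⟩
  have hKD : ⋂₀ 𝒰 ⊆ D := Set.sInter_subset_of_mem hD𝒰
  have hK : ⋂₀ 𝒰 ∈ 𝒰 := ⟨hKD, fun U hU => hU.2.1,
    fun u hu v hv huv U hU => hU.2.2 u (hu U hU) v hv huv⟩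
  have hbd : boundary G (⋂₀ 𝒰) ⊆ boundary G D := by
    rintro v ⟨hv, u, hu, huv⟩
    exact ⟨fun hvD => hv (hK.2.2 u hu v hvD huv), u, hKD hu, huv⟩
  refine ⟨⋂₀ 𝒰, hKD, ?_, ⟨hfin.subset hbd, t, fun i hi => ?_⟩, hbd⟩
  · intro U hU hne hcl
    refine hU.antisymm ?_
    by_cases hWU : W t ∈ U
    · refine Set.sInter_subset_of_mem ⟨hU.trans hKD, hWU, fun u hu v hv huv => ?_⟩
      exact hcl u hu v (hK.2.2 u (hU hu) v hv huv) huv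
    · have : ⋂₀ 𝒰 ⊆ ⋂₀ 𝒰 \ U := by
        refine Set.sInter_subset_of_mem
          ⟨Set.sdiff_subset.trans hKD, ⟨hK.2.1, hWU⟩, fun u hu v hv huv => ?_⟩
        exact ⟨hK.2.2 u hu.1 v hv huv, fun hvU => hu.2 (hcl v hvU u hu.1 huv.symm)⟩
      obtain ⟨u, hu⟩ := hne
      exact absurd hu (this (hU hu)).2
  · induction i, hi using Nat.le_induction with
    | base => exact hK.2.1
    | succ i hi ih => exact hK.2.2 _ ih _ (ht _ (by omega)) (hW.2 i)

lemma isRegion_compl (hW : IsRay G W) {X : Set V} (hX : X.Finite) : IsRegion G W Xᶜ := by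
  refine ⟨hX.subset fun v hv => not_not.1 hv.1, ?_⟩
  have h := hW.1.tendsto_cofinite.eventually hX.compl_mem_cofinite
  rw [Nat.cofinite_eq_atTop, Filter.eventually_atTop] at h
  exact h

lemma exists_isTight (hW : IsRay G W) {X : Set V} (hX : X.Finite) :
    ∃ C, IsTight G W C ∧ Disjoint C X := by
  classical
  have hex : ∃ n, ∃ D, IsRegion G W D ∧ Disjoint D X ∧ (boundary G D).ncard = n :=
    ⟨_, Xᶜ, isRegion_compl hW hX, disjoint_compl_left, rfl⟩
  obtain ⟨D, hD, hDX, hn⟩ := Nat.find_spec hex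
  obtain ⟨C, hCD, hC, hCr, hbd⟩ := hD.exists_isConn hW
  refine ⟨C, ⟨hC, hCr, fun E hE hEr => ?_⟩, hDX.mono_left hCD⟩
  calc (boundary G C).ncard ≤ (boundary G D).ncard := Set.ncard_le_ncard hbd hD.1
    _ = Nat.find hex := hn
    _ ≤ _ := Nat.find_min' hex ⟨E, hEr, hDX.mono_left (hE.trans hCD), rfl⟩

/-- Nested tight regions, the inner one keeping clear of a connected subset of the outer one
that contains all neighbours of the outer boundary. -/
def IsStep (G : SimpleGraph V) (C C' : Set V) : Prop :=
  C' ⊆ C ∧ boundary G C' ⊆ C ∧ ∃ Y ⊆ C, IsConn G Y ∧ Y.Nonempty ∧ Disjoint Y C' ∧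
    ∀ s ∈ boundary G C, ∀ v ∈ C, G.Adj s v → v ∈ Y

lemma IsTight.exists_isStep (hW : IsRay G W) (hlf : ∀ v, (G.neighborSet v).Finite)
    (hC : IsTight G W C) : ∃ C', IsTight G W C' ∧ IsStep G C C' := by
  obtain ⟨hconn, ⟨hfin, t, ht⟩, -⟩ := hC
  have hN : (⋃ s ∈ boundary G C, G.neighborSet s).Finite := hfin.biUnion fun s _ => hlf s
  obtain ⟨Y, hYC, hYf, hY, hxY, hFY⟩ := hconn.exists_finite_isConn (ht t le_rfl)
    (hN.inter_of_left C) Set.inter_subset_right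
  obtain ⟨C', hC', hdisj⟩ := exists_isTight hW ((hYf.union hfin).union hN)
  obtain ⟨t', ht'⟩ := hC'.2.1.2
  rw [Set.disjoint_union_right, Set.disjoint_union_right] at hdisj
  have hsub : C' ⊆ C := hC'.1.subset_of_mem hdisj.1.2
    (ht' (max t t') (le_max_right _ _)) (ht _ (le_max_left _ _))
  refine ⟨C', hC', hsub, ?_, Y, hYC, hY, ⟨_, hxY⟩, hdisj.1.1.symm, ?_⟩
  · rintro v ⟨hv, u, hu, huv⟩
    by_contra hvC
    refine Set.disjoint_left.1 hdisj.2 hu ?_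
    exact Set.mem_biUnion (x := v) ⟨hvC, u, hsub hu, huv⟩ huv.symm
  · exact fun s hs v hv hsv => hFY ⟨Set.mem_biUnion hs hsv, hv⟩

lemma mem_of_forall_notMem_boundary {f : ℕ → V} (hf : ∀ n, G.Adj (f n) (f (n + 1))) {a n : ℕ}
    (han : a ≤ n) (h : ∀ i, a ≤ i → f i ∉ boundary G C) (hn : f n ∈ C) : f a ∈ C := by
  induction n, han using Nat.le_induction with
  | base => exact hn
  | succ n han ih =>
    refine ih ?_
    by_contra hc
    exact h n han ⟨hc, _, hn, (hf n).symm⟩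

lemma mem_of_walk {u v : V} (w : G.Walk u v) (h : ∀ x ∈ w.support, x ∉ boundary G C)
    (hu : u ∈ C) : v ∈ C := by
  induction w with
  | nil => exact hu
  | @cons u x v hux w ih =>
    refine ih (fun y hy => h y (by simp [hy])) ?_
    by_contra hx
    exact h x (by simp) ⟨hx, u, hu, hux⟩

lemma IsRegion.exists_mem_boundary (hW : IsRay G W) (hC : IsRegion G W C) {f : ℕ → V}
    (hf : IsRay G f) (hWf : RayEquiv G W f) (h0 : f 0 ∉ C) : ∃ j, f j ∈ boundary G C := by
  obtain ⟨a, b, ha, -, w, hw⟩ := hWf hC.1.toFinset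
  obtain ⟨t, ht⟩ := hC.2
  simp only [Set.Finite.mem_toFinset] at ha hw
  by_contra! hcon
  have hWa : W a ∈ C :=
    mem_of_forall_notMem_boundary hW.2 (le_max_left a t) ha (ht _ (le_max_right a t))
  exact h0 (mem_of_forall_notMem_boundary hf.2 (Nat.zero_le b) (fun i _ => hcon i)
    (mem_of_walk w hw hWa))

lemma exists_injOn_of_forall_le [DecidableEq V] (H P Q : Finset V)
    (h : ∀ U ⊆ H \ Q, P.card ≤ (((P : Set V) \ U) ∪ {v | v ∈ H ∧ v ∉ U ∧ ∃ u ∈ U, G.Adj u v}).ncard) :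
    ∃ σ : V → V, Set.InjOn σ (H \ Q : Finset V) ∧ Set.MapsTo σ (H \ Q : Finset V) (H \ P : Finset V) ∧
      ∀ v ∈ H \ Q, σ v = v ∨ G.Adj v (σ v) := by
  classical
  let t : {v // v ∈ H \ Q} → Finset V := fun v => {x ∈ H \ P | x = v ∨ G.Adj v x}
  have hall : ∀ s : Finset {v // v ∈ H \ Q}, s.card ≤ (s.biUnion t).card := by
    intro s
    let U : Finset V := s.map (Function.Embedding.subtype _)
    have hU : U ⊆ H \ Q := by
      intro v hv
      obtain ⟨a, -, rfl⟩ := Finset.mem_map.1 hv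
      exact a.2
    have hUc : s.card = U.card := (Finset.card_map _).symm
    let N : Finset V := {v ∈ H | ∃ u ∈ U, v = u ∨ G.Adj u v}
    have hUN : U ⊆ N := fun v hv =>
      Finset.mem_filter.2 ⟨(Finset.mem_sdiff.1 (hU hv)).1, v, hv, .inl rfl⟩
    have ht : s.biUnion t = N \ P := by
      ext v
      simp only [Finset.mem_biUnion, Finset.mem_filter, Finset.mem_sdiff, t, N, U, Finset.mem_map,
        Function.Embedding.subtype_apply]
      constructor
      · rintro ⟨a, ha, ⟨hv, hvP⟩, hor⟩
        exact ⟨⟨hv, a, ⟨a, ha, rfl⟩, hor⟩, hvP⟩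
      · rintro ⟨⟨hv, _, ⟨a, ha, rfl⟩, hor⟩, hvP⟩
        exact ⟨a, ha, ⟨hv, hvP⟩, hor⟩
    have hS : ((P : Set V) \ U) ∪ {v | v ∈ H ∧ v ∉ U ∧ ∃ u ∈ U, G.Adj u v} =
        ((P ∪ N) \ U : Finset V) := by
      ext v
      simp only [Set.mem_union, Set.mem_sdiff, Finset.mem_coe, Set.mem_ofPred_eq, Finset.mem_sdiff,
        Finset.mem_union, N, Finset.mem_filter]
      constructor
      · rintro (h | ⟨hv, hvU, u, hu, huv⟩)
        exacts [⟨.inl h.1, h.2⟩, ⟨.inr ⟨hv, u, hu, .inr huv⟩, hvU⟩]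
      · rintro ⟨h | ⟨hv, u, hu, rfl | huv⟩, hvU⟩
        exacts [.inl ⟨h, hvU⟩, absurd hu hvU, .inr ⟨hv, hvU, u, hu, huv⟩]
    have h1 := h U hU
    rw [hS, Set.ncard_coe_finset] at h1
    have h2 := Finset.card_sdiff_add_card_eq_card (hUN.trans (Finset.subset_union_right (s₁ := P)))
    have h3 := Finset.card_sdiff_add_card N P
    rw [Finset.union_comm] at h3
    rw [ht, hUc]
    omega
  obtain ⟨f, hf, hft⟩ := (Finset.all_card_le_biUnion_card_iff_exists_injective t).1 hall
  refine ⟨fun v => if hv : v ∈ H \ Q then f ⟨v, hv⟩ else v, ?_, ?_, ?_⟩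
  · intro v hv w hw hvw
    rw [Finset.mem_coe] at hv hw
    simp only [hv, hw, dif_pos] at hvw
    exact congrArg Subtype.val (hf hvw)
  · intro v hv
    rw [Finset.mem_coe] at hv
    simp only [hv, dif_pos]
    exact (Finset.mem_filter.1 (hft ⟨v, hv⟩)).1
  · intro v hv
    simp only [hv, dif_pos]
    exact (Finset.mem_filter.1 (hft ⟨v, hv⟩)).2

/-- A lower bound on separators in `L` already holds in some finite subset of `L`. -/
lemma exists_finite_forall_le {L Q : Set V} {P T : Finset V} (hT : (T : Set V) ⊆ L)
    (h : ∀ U ⊆ L \ Q, ((P : Set V) \ U ∪ {v | v ∈ L ∧ v ∉ U ∧ ∃ u ∈ U, G.Adj u v}).Finite →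
      P.card ≤ ((P : Set V) \ U ∪ {v | v ∈ L ∧ v ∉ U ∧ ∃ u ∈ U, G.Adj u v}).ncard) :
    ∃ H : Finset V, T ⊆ H ∧ (H : Set V) ⊆ L ∧ ∀ U ⊆ (H : Set V) \ Q,
      P.card ≤ ((P : Set V) \ U ∪ {v | v ∈ H ∧ v ∉ U ∧ ∃ u ∈ U, G.Adj u v}).ncard := by
  classical
  by_contra! hcon
  have hcon' : ∀ H : Finset V, ∃ U ⊆ (((H ∪ T).filter (· ∈ L) : Finset V) : Set V) \ Q,
      ((P : Set V) \ U ∪ {v | v ∈ (H ∪ T).filter (· ∈ L) ∧ v ∉ U ∧ ∃ u ∈ U, G.Adj u v}).ncard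
        < P.card := fun H => hcon _
    (fun v hv => Finset.mem_filter.2 ⟨Finset.mem_union_right _ hv, hT hv⟩)
    (fun v hv => (Finset.mem_filter.1 hv).2)
  choose U hUsub hU using hcon'
  let l : Ultrafilter (Finset V) := Ultrafilter.of Filter.atTop
  have hl : ∀ v : V, ∀ᶠ H : Finset V in l, v ∈ H := fun v =>
    Ultrafilter.of_le Filter.atTop <| (Filter.eventually_ge_atTop {v}).mono
      fun _ hH => Finset.singleton_subset_iff.1 hH
  let U' : Set V := {v | ∀ᶠ H in l, v ∈ U H}
  have hnot : ∀ v ∉ U', ∀ᶠ H in l, v ∉ U H := fun v hv => Ultrafilter.eventually_not.2 hv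
  let S : Set V := (P : Set V) \ U' ∪ {v | v ∈ L ∧ v ∉ U' ∧ ∃ u ∈ U', G.Adj u v}
  let S' : Finset V → Set V := fun H =>
    (P : Set V) \ U H ∪ {v | v ∈ (H ∪ T).filter (· ∈ L) ∧ v ∉ U H ∧ ∃ u ∈ U H, G.Adj u v}
  have hS : ∀ v ∈ S, ∀ᶠ H in l, v ∈ S' H := by
    rintro v (⟨hvP, hv⟩ | ⟨hvL, hv, u, hu, huv⟩)
    · filter_upwards [hnot v hv] with H hH using .inl ⟨hvP, hH⟩
    · filter_upwards [hnot v hv, hl v, hu] with H h1 h2 h3 using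
        .inr ⟨Finset.mem_filter.2 ⟨Finset.mem_union_left _ h2, hvL⟩, h1, u, h3, huv⟩
  have hS'fin : ∀ H, (S' H).Finite := fun H => (P.finite_toSet.subset Set.sdiff_subset).union
    (((H ∪ T).filter (· ∈ L)).finite_toSet.subset fun v hv => hv.1)
  have hsmall : ∀ R : Finset V, (R : Set V) ⊆ S → R.card < P.card := by
    intro R hR
    have : ∀ᶠ H in l, ∀ v ∈ R, v ∈ S' H := (Filter.eventually_all_finset R).2 fun v hv => hS v (hR hv)
    obtain ⟨H, hH⟩ := this.exists
    refine lt_of_le_of_lt ?_ (hU H)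
    rw [← Set.ncard_coe_finset]
    exact Set.ncard_le_ncard hH (hS'fin H)
  have hSfin : S.Finite := by
    by_contra hinf
    obtain ⟨R, hR, hRc⟩ := Set.Infinite.exists_subset_card_eq hinf P.card
    exact absurd (hsmall R hR) (by omega)
  refine absurd (h U' (fun v hv => ?_) hSfin) (not_le.2 ?_)
  · obtain ⟨H, hH⟩ := Filter.Eventually.exists (f := (l : Filter (Finset V))) hv
    have := hUsub H hH
    exact ⟨(Finset.mem_filter.1 this.1).2, this.2⟩
  · rw [Set.ncard_eq_toFinset_card _ hSfin]
    exact hsmall _ (by simp)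

lemma iterate_eq_iterate {α : Type*} {σ : α → α} {s P : Set α} (hP : P ⊆ s) (hm : Set.MapsTo σ s s)
    (hi : Set.InjOn σ s) (hσP : ∀ x ∈ s, σ x ∉ P) {x y : α} (hx : x ∈ P) (hy : y ∈ P) :
    ∀ {i j : ℕ}, σ^[i] x = σ^[j] y → i = j ∧ x = y
  | 0, 0, h => ⟨rfl, h⟩
  | 0, j + 1, h => by
    rw [Function.iterate_succ_apply'] at h
    exact absurd (h ▸ hx) (hσP _ (hm.iterate j (hP hy)))
  | i + 1, 0, h => by
    rw [Function.iterate_succ_apply'] at h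
    exact absurd (h.symm ▸ hy) (hσP _ (hm.iterate i (hP hx)))
  | i + 1, j + 1, h => by
    rw [Function.iterate_succ_apply', Function.iterate_succ_apply'] at h
    obtain ⟨rfl, hxy⟩ := iterate_eq_iterate hP hm hi hσP hx hy
      (hi (hm.iterate i (hP hx)) (hm.iterate j (hP hy)) h)
    exact ⟨rfl, hxy⟩

/-- A nested sequence of tight regions. -/
structure IsTower (G : SimpleGraph V) (W : ℕ → V) (C : ℕ → Set V) : Prop where
  tight : ∀ n, IsTight G W (C n)
  step : ∀ n, IsStep G (C n) (C (n + 1))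

namespace IsTower

variable {C : ℕ → Set V}

lemma antitone (hC : IsTower G W C) : Antitone C := antitone_nat_of_succ_le fun n => (hC.step n).1

lemma boundary_subset (hC : IsTower G W C) {m n : ℕ} (h : m < n) : boundary G (C n) ⊆ C m := by
  obtain ⟨n, rfl⟩ : ∃ j, n = j + 1 := ⟨n - 1, by omega⟩
  exact (hC.step n).2.1.trans (hC.antitone (by omega))

lemma shift (hC : IsTower G W C) (m : ℕ) : IsTower G W fun n => C (m + n) :=
  ⟨fun n => hC.tight (m + n), fun n => hC.step (m + n)⟩

lemma exists_notMem (hC : IsTower G W C) (hc : G.Connected) (h0 : (boundary G (C 0)).Nonempty)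
    (v : V) : ∃ n, v ∉ C n := by
  obtain ⟨x, hx⟩ := h0
  obtain ⟨w⟩ := hc.preconnected v x
  refine ⟨w.length, fun hv => hx.1 ?_⟩
  clear hc
  induction w with
  | nil => exact hv
  | @cons u y z huy w ih =>
    refine ih hx ?_
    by_contra hy
    rw [Walk.length_cons] at hv
    exact hy (hC.boundary_subset (Nat.lt_succ_self _)
      ⟨fun hy' => hy (hC.antitone (Nat.le_succ _) hy'), u, hv, huy⟩)

lemma exists_disjoint (hC : IsTower G W C) (hc : G.Connected) (h0 : (boundary G (C 0)).Nonempty)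
    (S : Finset V) : ∃ n, ∀ v ∈ S, v ∉ C n := by
  choose N hN using hC.exists_notMem hc h0
  exact ⟨S.sup N, fun v hv h => hN v (hC.antitone (Finset.le_sup hv) h)⟩

lemma ncard_boundary_le (hC : IsTower G W C) (n : ℕ) {U : Set V}
    (hU : U ⊆ ((C n ∪ boundary G (C n)) \ C (n + 1)) \ boundary G (C (n + 1)))
    (hfin : (boundary G (C n) \ U ∪
      {v | v ∈ (C n ∪ boundary G (C n)) \ C (n + 1) ∧ v ∉ U ∧ ∃ u ∈ U, G.Adj u v}).Finite) :
    (boundary G (C n)).ncard ≤ (boundary G (C n) \ U ∪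
      {v | v ∈ (C n ∪ boundary G (C n)) \ C (n + 1) ∧ v ∉ U ∧ ∃ u ∈ U, G.Adj u v}).ncard := by
  set S := boundary G (C n) \ U ∪
    {v | v ∈ (C n ∪ boundary G (C n)) \ C (n + 1) ∧ v ∉ U ∧ ∃ u ∈ U, G.Adj u v} with hS
  have hsub := (hC.step n).1
  have hbd : boundary G (C n \ (U ∪ S)) ⊆ S := by
    rintro v ⟨hv, u, ⟨hu, huUS⟩, huv⟩
    by_contra hvS
    have hvU : v ∈ U := by
      by_cases hvC : v ∈ C n
      · by_contra hvU
        exact hv ⟨hvC, fun h => h.elim hvU hvS⟩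
      · by_contra hvU
        exact hvS (.inl ⟨⟨hvC, u, hu, huv⟩, hvU⟩)
    refine huUS (.inr (.inr ⟨⟨.inl hu, fun huC => ?_⟩, fun h => huUS (.inl h), v, hvU, huv.symm⟩))
    exact (hU hvU).2 ⟨(hU hvU).1.2, u, huC, huv⟩
  refine ((hC.tight n).2.2 _ Set.sdiff_subset ⟨hfin.subset hbd, ?_⟩).trans
    (Set.ncard_le_ncard hbd hfin)
  obtain ⟨t, ht⟩ := (hC.tight (n + 1)).2.1.2
  refine ⟨t, fun i hi => ⟨hsub (ht i hi), ?_⟩⟩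
  rintro (h | h | h)
  · exact (hU h).1.2 (ht i hi)
  · exact h.1.1 (hsub (ht i hi))
  · exact h.1.2 (ht i hi)

lemma exists_linkage (hC : IsTower G W C) (n : ℕ) : ∃ (H : Set V) (σ : V → V), H.Finite ∧
    boundary G (C n) ⊆ H ∧ boundary G (C (n + 1)) ⊆ H ∧
    H ⊆ (C n ∪ boundary G (C n)) \ C (n + 1) ∧ Set.InjOn σ (H \ boundary G (C (n + 1))) ∧
    Set.MapsTo σ (H \ boundary G (C (n + 1))) (H \ boundary G (C n)) ∧
    ∀ v ∈ H \ boundary G (C (n + 1)), σ v = v ∨ G.Adj v (σ v) := by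
  classical
  obtain ⟨P, hP⟩ := (hC.tight n).2.1.1.exists_finset_coe
  obtain ⟨Q, hQ⟩ := (hC.tight (n + 1)).2.1.1.exists_finset_coe
  have hT : ((P ∪ Q : Finset V) : Set V) ⊆ (C n ∪ boundary G (C n)) \ C (n + 1) := by
    rw [Finset.coe_union, hP, hQ]
    rintro v (h | h)
    · exact ⟨.inr h, fun hv => h.1 ((hC.step n).1 hv)⟩
    · exact ⟨.inl ((hC.step n).2.1 h), h.1⟩
  obtain ⟨H, hTH, hHL, hH⟩ := exists_finite_forall_le (G := G) (P := P) (Q := Q) hT (by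
    intro U hU hfin
    rw [← Set.ncard_coe_finset P]
    rw [hQ] at hU
    rw [hP] at hfin ⊢
    exact hC.ncard_boundary_le n hU hfin)
  obtain ⟨σ, h1, h2, h3⟩ := exists_injOn_of_forall_le H P Q
    fun U hU => hH U (by rw [← Finset.coe_sdiff]; exact_mod_cast hU)
  rw [Finset.coe_sdiff, hQ] at h1 h2
  rw [Finset.coe_sdiff, hP] at h2
  refine ⟨H, σ, H.finite_toSet, hP ▸ ?_, hQ ▸ ?_, hHL, h1, h2, fun v hv => h3 v ?_⟩
  · exact_mod_cast Finset.union_subset_left hTH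
  · exact_mod_cast Finset.union_subset_right hTH
  · rw [← hQ] at hv
    exact Finset.mem_sdiff.2 hv

lemma exists_rays (hC : IsTower G W C) (hc : G.Connected) (h0 : (boundary G (C 0)).Nonempty) :
    ∃ F : boundary G (C 0) → ℕ → V, (∀ s, IsRay G (F s) ∧ RayEquiv G W (F s)) ∧
      Pairwise fun s t => Disjoint (Set.range (F s)) (Set.range (F t)) := by
  classical
  choose H τ hfin hP hQ hHL hinj hmaps hadj using hC.exists_linkage
  have hlevel : ∀ {v m n}, v ∈ H m \ boundary G (C (m + 1)) → v ∈ H n \ boundary G (C (n + 1)) →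
      m ≤ n := by
    intro v m n hm hn
    by_contra! hlt
    rcases (hHL m hm.1).1 with h | h
    · exact (hHL n hn.1).2 (hC.antitone (by omega) h)
    · rcases (show n + 1 ≤ m by omega).eq_or_lt with rfl | hlt'
      · exact hn.2 h
      · exact (hHL n hn.1).2 (hC.boundary_subset hlt' h)
  have hlevel' : ∀ {v m n}, v ∈ H m \ boundary G (C m) → v ∈ H n \ boundary G (C n) →
      m ≤ n := by
    intro v m n hm hn
    by_contra! hlt
    have : v ∈ C m := (hHL m hm.1).1.resolve_right hm.2
    exact (hHL n hn.1).2 (hC.antitone (by omega) this)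
  let s : Set V := ⋃ n, H n \ boundary G (C (n + 1))
  let σ : V → V := fun v => if h : ∃ n, v ∈ H n \ boundary G (C (n + 1)) then τ h.choose v else v
  have hσ : ∀ {v n}, v ∈ H n \ boundary G (C (n + 1)) → σ v = τ n v := by
    intro v n hv
    have h : ∃ n, v ∈ H n \ boundary G (C (n + 1)) := ⟨n, hv⟩
    have hn : h.choose = n := le_antisymm (hlevel h.choose_spec hv) (hlevel hv h.choose_spec)
    simp only [σ, dif_pos h, hn]
  have hPs : ∀ n, boundary G (C n) ⊆ s := fun n v hv => Set.mem_iUnion.2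
    ⟨n, hP n hv, fun h => hv.1 (hC.boundary_subset (Nat.lt_succ_self n) h)⟩
  have hms : Set.MapsTo σ s s := by
    intro v hv
    obtain ⟨n, hv⟩ := Set.mem_iUnion.1 hv
    rw [hσ hv]
    by_cases h : τ n v ∈ boundary G (C (n + 1))
    · exact hPs (n + 1) h
    · exact Set.mem_iUnion.2 ⟨n, (hmaps n hv).1, h⟩
  have his : Set.InjOn σ s := by
    intro v hv w hw hvw
    obtain ⟨m, hv⟩ := Set.mem_iUnion.1 hv
    obtain ⟨n, hw⟩ := Set.mem_iUnion.1 hw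
    rw [hσ hv, hσ hw] at hvw
    have h1 := hmaps m hv
    have h2 := hmaps n hw
    obtain rfl : m = n := by
      refine le_antisymm (hlevel' h1 ?_) (hlevel' h2 ?_)
      · rwa [hvw]
      · rwa [← hvw]
    exact hinj m hv hw hvw
  have hσP : ∀ v ∈ s, σ v ∉ boundary G (C 0) := by
    intro v hv h
    obtain ⟨n, hv⟩ := Set.mem_iUnion.1 hv
    rw [hσ hv] at h
    have h1 := hmaps n hv
    exact h.1 (hC.antitone (Nat.zero_le n) ((hHL n h1.1).1.resolve_right h1.2))
  have hfar : ∀ n, (s \ C n).Finite := by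
    intro n
    refine (((Set.finite_lt_nat n).biUnion fun m _ => hfin m).union
      (hC.tight n).2.1.1).subset ?_
    rintro v ⟨hv, hvC⟩
    obtain ⟨m, hv⟩ := Set.mem_iUnion.1 hv
    rcases lt_or_ge m n with hmn | hmn
    · exact .inl (Set.mem_biUnion (show m ∈ {i | i < n} from hmn) hv.1)
    · rcases (hHL m hv.1).1 with h | h
      · exact absurd (hC.antitone hmn h) hvC
      · rcases hmn.eq_or_lt with rfl | hlt
        · exact .inr h
        · exact absurd (hC.boundary_subset hlt h) hvC
  have hmem : ∀ (x : boundary G (C 0)) (i : ℕ), σ^[i] x ∈ s := fun x i =>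
    hms.iterate i (hPs 0 x.2)
  have hinj' : ∀ x : boundary G (C 0), Function.Injective fun i => σ^[i] (x : V) :=
    fun x i j h => (iterate_eq_iterate (hPs 0) hms his hσP x.2 x.2 h).1
  refine ⟨fun x i => σ^[i] x, fun x => ⟨⟨hinj' x, fun i => ?_⟩, fun S => ?_⟩, fun x y hxy => ?_⟩
  · obtain ⟨n, hn⟩ := Set.mem_iUnion.1 (hmem x i)
    have hor := hadj n _ hn
    rw [← hσ hn, ← Function.iterate_succ_apply' σ] at hor
    exact hor.resolve_left fun h => Nat.succ_ne_self i (hinj' x h)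
  · obtain ⟨n, hn⟩ := hC.exists_disjoint hc h0 S
    obtain ⟨a, ha⟩ := (hC.tight n).2.1.2
    have hev := (hinj' x).tendsto_cofinite.eventually (hfar n).compl_mem_cofinite
    rw [Nat.cofinite_eq_atTop, Filter.eventually_atTop] at hev
    obtain ⟨b, hb⟩ := hev
    have hb' : ∀ j, b ≤ j → σ^[j] (x : V) ∈ C n := fun j hj => by
      by_contra h
      exact hb j hj ⟨hmem x j, h⟩
    obtain ⟨w, hw⟩ := (hC.tight n).1.exists_walk (ha a le_rfl) (hb' b le_rfl)
    exact ⟨a, b, fun i hi h => hn _ h (ha i hi), fun j hj h => hn _ h (hb' j hj), w,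
      fun v hv h => hn v h (hw v hv)⟩
  · refine Set.disjoint_left.2 ?_
    rintro _ ⟨i, rfl⟩ ⟨j, h⟩
    exact hxy (Subtype.ext (iterate_eq_iterate (hPs 0) hms his hσP x.2 y.2 h.symm).2)

end IsTower

lemma exists_isTower (hW : IsRay G W) (hlf : ∀ v, (G.neighborSet v).Finite) {X : Set V}
    (hX : X.Finite) : ∃ C, IsTower G W C ∧ Disjoint (C 0) X := by
  obtain ⟨C₀, hC₀, hdisj⟩ := exists_isTight hW hX
  choose next hnext using fun C : {C // IsTight G W C} => C.2.exists_isStep hW hlf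
  let C : ℕ → {C // IsTight G W C} :=
    fun n => Nat.rec ⟨C₀, hC₀⟩ (fun _ D => ⟨next D, (hnext D).1⟩) n
  refine ⟨fun n => (C n).1, ⟨fun n => (C n).2, fun n => (hnext (C n)).2⟩, hdisj⟩

lemma rayEquiv_tail (hW : IsRay G W) (t : ℕ) : RayEquiv G W fun i => W (t + i) := by
  intro S
  obtain ⟨a, ha⟩ := (isRegion_compl hW S.finite_toSet).2
  refine ⟨a, a, fun i hi h => ha i hi h, fun j hj h => ha (t + j) (by omega) h, ?_⟩
  induction t with
  | zero => exact ⟨Walk.nil.copy rfl (by simp), by simpa using ha a le_rfl⟩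
  | succ t ih =>
    obtain ⟨w, hw⟩ := ih
    have hadj : G.Adj (W (t + a)) (W (t + 1 + a)) := by
      rw [show t + 1 + a = t + a + 1 by omega]
      exact hW.2 _
    refine ⟨w.concat hadj, fun v hv => ?_⟩
    rw [Walk.support_concat, List.mem_append, List.mem_singleton] at hv
    rcases hv with hv | rfl
    exacts [hw v hv, ha _ (by omega)]

/-- The subgraph induced on the complement of `C`. -/
def outer (G : SimpleGraph V) (C : Set V) : G.Subgraph where
  verts := Cᶜ
  Adj u v := G.Adj u v ∧ u ∉ C ∧ v ∉ C
  adj_sub h := h.1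
  edge_vert h := h.2.1
  symm := ⟨fun _ _ h => ⟨h.1.symm, h.2.2, h.2.1⟩⟩

/-- The subgraph of all edges with an end in `C`. -/
def inner (G : SimpleGraph V) (C : Set V) : G.Subgraph where
  verts := C ∪ boundary G C
  Adj u v := G.Adj u v ∧ (u ∈ C ∨ v ∈ C)
  adj_sub h := h.1
  edge_vert := by
    rintro u v ⟨h, h' | h'⟩
    · exact .inl h'
    · by_cases hu : u ∈ C
      exacts [.inl hu, .inr ⟨hu, v, h', h.symm⟩]
  symm := ⟨fun _ _ h => ⟨h.1.symm, h.2.symm⟩⟩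

lemma outer_sup_inner (G : SimpleGraph V) (C : Set V) : outer G C ⊔ inner G C = ⊤ := by
  refine Subgraph.ext ?_ ?_
  · ext v
    simp only [Subgraph.verts_sup, outer, inner, Subgraph.verts_top, Set.mem_union, Set.mem_compl_iff,
      Set.mem_univ, iff_true]
    tauto
  · ext u v
    simp only [Subgraph.sup_adj, outer, inner, Subgraph.top_adj]
    tauto

lemma disjoint_edgeSet_outer_inner (G : SimpleGraph V) (C : Set V) :
    Disjoint (outer G C).edgeSet (inner G C).edgeSet := by
  rw [Set.disjoint_left]
  intro e
  induction e with
  | _ u v =>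
    simp only [Subgraph.mem_edgeSet, outer, inner]
    tauto

lemma verts_outer_inter_inner (G : SimpleGraph V) (C : Set V) :
    (outer G C).verts ∩ (inner G C).verts = boundary G C := by
  ext v
  simp only [outer, inner, Set.mem_inter_iff, Set.mem_compl_iff, Set.mem_union]
  exact ⟨fun h => h.2.resolve_left h.1, fun h => ⟨h.1, .inr h⟩⟩

lemma connected_outer_inf_inner {C C' : Set V} (hC : IsTight G W C) (hC' : IsTight G W C')
    (h : IsStep G C C') (hcard : (boundary G C').ncard ≤ (boundary G C).ncard) :
    (outer G C' ⊓ inner G C).Connected := by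
  obtain ⟨hsub, hbd, Y, hYC, hY, ⟨y, hy⟩, hYC', hnb⟩ := h
  set K := outer G C' ⊓ inner G C with hK
  have hKadj : ∀ {u v}, K.Adj u v ↔ G.Adj u v ∧ u ∉ C' ∧ v ∉ C' ∧ (u ∈ C ∨ v ∈ C) := by
    intro u v
    simp only [hK, Subgraph.inf_adj, outer, inner]
    tauto
  have hKv : ∀ {v}, v ∈ K.verts ↔ v ∉ C' ∧ (v ∈ C ∨ v ∈ boundary G C) := by
    intro v
    rfl
  have hyK : y ∈ K.verts := hKv.2 ⟨Set.disjoint_left.1 hYC' hy, .inl (hYC hy)⟩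
  let R : Set V := {v | ∃ hv : v ∈ K.verts, K.coe.Reachable ⟨y, hyK⟩ ⟨v, hv⟩}
  have hR : ∀ {u v}, u ∈ R → K.Adj u v → v ∈ R := by
    rintro u v ⟨hu, hr⟩ huv
    exact ⟨huv.snd_mem, hr.trans (Adj.reachable (G := K.coe) (v := ⟨v, huv.snd_mem⟩) huv)⟩
  have hYR : Y ⊆ R := by
    refine Set.inter_eq_left.1 (hY _ Set.inter_subset_left
      ⟨y, hy, hyK, Reachable.refl _⟩ fun u hu v hv huv => ⟨hv, hR hu.2 (hKadj.2 ⟨huv, ?_⟩)⟩)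
    exact ⟨Set.disjoint_left.1 hYC' hu.1, Set.disjoint_left.1 hYC' hv, .inl (hYC hu.1)⟩
  have hbR : boundary G C ⊆ R := by
    rintro s hs
    obtain ⟨u, hu, hus⟩ := hs.2
    have huY := hnb s hs u hu hus.symm
    exact hR (hYR huY) (hKadj.2 ⟨hus, Set.disjoint_left.1 hYC' huY, fun h => hs.1 (hsub h), .inl hu⟩)
  have hall : K.verts ⊆ R := by
    by_contra hne
    obtain ⟨x, hxK, hxR⟩ := Set.not_subset.1 hne
    let U := K.verts \ R
    have hUC : U ⊆ C := fun v hv => (hKv.1 hv.1).2.resolve_right fun h => hv.2 (hbR h)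
    have hUnb : ∀ u ∈ U, ∀ v, G.Adj u v → v ∉ C' → v ∈ U := by
      intro u hu v huv hv
      have hadj : K.Adj u v := hKadj.2 ⟨huv, (hKv.1 hu.1).1, hv, .inl (hUC hu)⟩
      exact ⟨hadj.snd_mem, fun h => hu.2 (hR h hadj.symm)⟩
    obtain ⟨t, ht⟩ := hC'.2.1.2
    obtain ⟨u, hu, v, hv, huv⟩ : ∃ u ∈ U, ∃ v ∈ C', G.Adj u v := by
      by_contra! hno
      have hUeq : U = C := hC.1 U hUC ⟨x, hxK, hxR⟩
        fun u hu v _ huv => hUnb u hu v huv fun h => hno u hu v h huv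
      have : W t ∈ U := hUeq ▸ hsub (ht t le_rfl)
      exact (hKv.1 this.1).1 (ht t le_rfl)
    have hbdU : boundary G (C' ∪ U) ⊆ boundary G C' \ {u} := by
      rintro z ⟨hz, z', hz' | hz', hzz'⟩
      · exact ⟨⟨fun h => hz (.inl h), z', hz', hzz'⟩, fun h => hz (.inr (h ▸ hu))⟩
      · exact absurd (.inr (hUnb z' hz' z hzz' fun h => hz (.inl h))) hz
    have hfin := hC'.2.1.1
    have hlt : (boundary G (C' ∪ U)).ncard < (boundary G C').ncard :=
      (Set.ncard_le_ncard hbdU hfin.sdiff).trans_lt (Set.ncard_sdiff_singleton_lt_of_mem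
        ⟨(hKv.1 hu.1).1, v, hv, huv.symm⟩ hfin)
    have := hC.2.2 (C' ∪ U) (Set.union_subset hsub hUC)
      ⟨hfin.subset (hbdU.trans Set.sdiff_subset), t, fun i hi => .inl (ht i hi)⟩
    omega
  rw [Subgraph.connected_iff']
  refine (connected_iff_exists_forall_reachable _).2 ⟨⟨y, hyK⟩, ?_⟩
  rintro ⟨v, hv⟩
  exact (hall hv).2

end EndSeparation

open EndSeparation

/-- A locally finite connected graph with an end `ω` (represented by `W`) of finite
vertex-degree `k` admits a sequence of separations capturing `ω`. -/
theorem stmt_11 (G : SimpleGraph V) (hc : G.Connected)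
    (hlf : ∀ v : V, (G.neighborSet v).Finite)
    (W : ℕ → V) (k : ℕ) (hW : IsRay G W) (hdeg : EndVertexDegree G W k) :
    ∃ A B : ℕ → G.Subgraph,
      (∀ i, A i ⊔ B i = ⊤ ∧ Disjoint (A i).edgeSet (B i).edgeSet) ∧
      (∀ i, (A i).verts ∩ (B (i + 1)).verts = ∅) ∧
      (∀ i, (A (i + 1) ⊓ B i).Connected) ∧
      (⨆ i, A i) = ⊤ ∧
      (∀ i, ((A i).verts ∩ (B i).verts).ncard = k) ∧
      (∀ i, ∃ f : ℕ → V, IsRay G f ∧ RayEquiv G W f ∧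
        Set.range f ⊆ (B i).verts ∧ rayEdges f ⊆ (B i).edgeSet) := by
  obtain ⟨⟨F, hF, hFdisj⟩, hno⟩ := hdeg
  obtain ⟨C, hC, hdisj⟩ := exists_isTower hW hlf (Set.finite_range fun j => F j 0)
  have hlow : ∀ n, k ≤ (boundary G (C n)).ncard := by
    intro n
    have hcross : ∀ j, ∃ i, F j i ∈ boundary G (C n) := fun j =>
      (hC.tight n).2.1.exists_mem_boundary hW (hF j).1 (hF j).2 fun h =>
        Set.disjoint_left.1 hdisj (hC.antitone (Nat.zero_le n) h) ⟨j, rfl⟩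
    choose i hi using hcross
    have hinj : Function.Injective fun j => F j (i j) := by
      intro a b hab
      by_contra hne
      exact Set.disjoint_left.1 (hFdisj hne) ⟨i a, rfl⟩ ⟨i b, hab.symm⟩
    have := Set.ncard_le_ncard (Set.range_subset_iff.2 hi) (hC.tight n).2.1.1
    rwa [← Set.image_univ, Set.ncard_image_of_injective _ hinj, Set.ncard_univ,
      Nat.card_eq_fintype_card, Fintype.card_fin] at this
  have hupp : ∀ n, (boundary G (C n)).ncard ≤ k := by
    intro n
    by_contra! hlt
    have hne : (boundary G (C n)).Nonempty := Set.nonempty_of_ncard_ne_zero (by omega)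
    obtain ⟨F', hF', hdisj'⟩ := (hC.shift n).exists_rays hc hne
    have hfin : Finite (boundary G (C (n + 0))) := (hC.tight n).2.1.1
    have := Fintype.ofFinite (boundary G (C (n + 0)))
    obtain ⟨e⟩ : Nonempty (Fin (k + 1) ↪ boundary G (C (n + 0))) := by
      refine Function.Embedding.nonempty_of_card_le ?_
      rw [Fintype.card_fin, ← Nat.card_eq_fintype_card]
      exact hlt
    exact hno ⟨fun j => F' (e j), fun j => hF' _, fun a b hab => hdisj' (e.injective.ne hab)⟩
  have hcard : ∀ n, (boundary G (C n)).ncard = k := fun n => (hupp n).antisymm (hlow n)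
  have hk : k ≠ 0 := by
    rintro rfl
    exact hno ⟨fun _ i => W (0 + i), fun _ => ⟨by simpa using hW, rayEquiv_tail hW 0⟩,
      fun a b hab => absurd (Fin.ext (by omega)) hab⟩
  have hne : (boundary G (C 0)).Nonempty := Set.nonempty_of_ncard_ne_zero (by rwa [hcard])
  refine ⟨fun i => outer G (C i), fun i => inner G (C i),
    fun i => ⟨outer_sup_inner G _, disjoint_edgeSet_outer_inner G _⟩, fun i => ?_,
    fun i => connected_outer_inf_inner (hC.tight i) (hC.tight (i + 1)) (hC.step i)
      (by rw [hcard, hcard]), ?_, fun i => ?_, fun i => ?_⟩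
  · rw [← Set.disjoint_iff_inter_eq_empty]
    exact disjoint_compl_left.mono_right (Set.union_subset (hC.step i).1 (hC.step i).2.1)
  · refine Subgraph.ext ?_ ?_
    · rw [Subgraph.verts_iSup, Subgraph.verts_top, Set.eq_univ_iff_forall]
      exact fun v => Set.mem_iUnion.2 (hC.exists_notMem hc hne v)
    · ext u v
      rw [Subgraph.iSup_adj, Subgraph.top_adj]
      refine ⟨fun ⟨i, h⟩ => h.1, fun h => ?_⟩
      classical
      obtain ⟨n, hn⟩ := hC.exists_disjoint hc hne {u, v}
      exact ⟨n, h, hn u (by simp), hn v (by simp)⟩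
  · rw [verts_outer_inter_inner, hcard]
  · obtain ⟨t, ht⟩ := (hC.tight i).2.1.2
    refine ⟨fun j => W (t + j), ⟨fun a b hab => Nat.add_left_cancel (hW.1 hab), fun n => hW.2 (t + n)⟩,
      rayEquiv_tail hW t, ?_, ?_⟩
    · rintro _ ⟨j, rfl⟩
      exact .inl (ht _ (by omega))
    · rintro _ ⟨j, rfl⟩
      exact ⟨hW.2 (t + j), .inl (ht _ (by omega))⟩
end
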